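/- arXiv:1611.03549 — 2 statements merged into one kernel-verified Lean document; each statement's English description precedes it below -/
import Mathlib

section
/- Let A : ℝ^{nN} → ℝ^{nN} satisfy the (p,q)-ellipticity and growth conditions, the skew-symmetry control, and let u : Ω → ℝ^N be a twice continuously differentiable weak solution of the system div A(Du) = 0 in Ω. Then there exists a constant c > 0, depending only on n, N, p, q, m, M, such that for every smooth compactly supported function η : ℝⁿ → ℝ with support contained in Ω one has ∫_Ω |D(V(Du))|² η² dx ≤ c ∫_Ω (1+|Du|²)^{q/2} |Dη|² dx, where D(V(Du)) denotes the derivative of the map x ↦ V(Du(x)). -/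
open MeasureTheory Real

noncomputable section

abbrev Vec (n N : ℕ) := EuclideanSpace ℝ (Fin n × Fin N)

abbrev Pt (n : ℕ) := EuclideanSpace ℝ (Fin n)

def dA {n N : ℕ} (A : Vec n N → Vec n N) (ξ : Vec n N)
    (i : Fin n) (α : Fin N) (j : Fin n) (β : Fin N) : ℝ :=
  fderiv ℝ A ξ (EuclideanSpace.single (j, β) 1) (i, α)

structure EllipticGrowth (n N : ℕ) (p q m M : ℝ) (A : Vec n N → Vec n N) : Prop where
  differentiable : Differentiable ℝ A
  ellipticity : ∀ ξ lam : Vec n N,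
    m * (1 + ‖ξ‖ ^ 2) ^ ((p - 2) / 2) * ‖lam‖ ^ 2 ≤
      ∑ i : Fin n, ∑ j : Fin n, ∑ α : Fin N, ∑ β : Fin N,
        dA A ξ i α j β * lam (i, α) * lam (j, β)
  growth : ∀ (ξ : Vec n N) (i : Fin n) (α : Fin N) (j : Fin n) (β : Fin N),
    |dA A ξ i α j β| ≤ M * (1 + ‖ξ‖ ^ 2) ^ ((q - 2) / 2)

def SkewControl (n N : ℕ) (p q M : ℝ) (A : Vec n N → Vec n N) : Prop :=
  ∀ (ξ : Vec n N) (i : Fin n) (α : Fin N) (j : Fin n) (β : Fin N),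
    |dA A ξ i α j β - dA A ξ j β i α| ≤ M * (1 + ‖ξ‖ ^ 2) ^ ((q + p - 4) / 4)

def grad {n N : ℕ} (u : Pt n → EuclideanSpace ℝ (Fin N)) (x : Pt n) : Vec n N :=
  (WithLp.equiv 2 ((Fin n × Fin N) → ℝ)).symm
    fun iα => fderiv ℝ u x (EuclideanSpace.single iα.1 1) iα.2

def hessSq {n N : ℕ} (u : Pt n → EuclideanSpace ℝ (Fin N)) (x : Pt n) : ℝ :=
  ∑ i : Fin n, ∑ k : Fin n, ∑ α : Fin N,
    (fderiv ℝ (fun y => fderiv ℝ u y (EuclideanSpace.single i 1) α) x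
      (EuclideanSpace.single k 1)) ^ 2

def IsWeakSolution {n N : ℕ} (A : Vec n N → Vec n N) (Ω : Set (Pt n))
    (u : Pt n → EuclideanSpace ℝ (Fin N)) : Prop :=
  ∀ φ : Pt n → EuclideanSpace ℝ (Fin N),
    ContDiff ℝ (⊤ : ℕ∞) φ → HasCompactSupport φ → tsupport φ ⊆ Ω →
    ∫ x in Ω, ∑ i : Fin n, ∑ α : Fin N,
      A (grad u x) (i, α) * fderiv ℝ φ x (EuclideanSpace.single i 1) α = 0

def Vmap {n N : ℕ} (p : ℝ) (ξ : Vec n N) : Vec n N := ((1 + ‖ξ‖ ^ 2) ^ ((p - 2) / 4)) • ξ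

def gradVSq {n N : ℕ} (p : ℝ) (u : Pt n → EuclideanSpace ℝ (Fin N)) (x : Pt n) : ℝ :=
  ∑ k : Fin n, ‖fderiv ℝ (fun y => Vmap p (grad u y)) x (EuclideanSpace.single k 1)‖ ^ 2

def Aeps {n N : ℕ} (q ε : ℝ) (A : Vec n N → Vec n N) (ξ : Vec n N) : Vec n N :=
  A ξ + (ε * (1 + ‖ξ‖ ^ 2) ^ ((max q 2 - 2) / 2)) • ξ


open Filter Topology
open scoped InnerProductSpace

theorem inner_fderiv_eq_sum {n N : ℕ} (A : Vec n N → Vec n N) (ξ lam μ : Vec n N) :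
    ⟪fderiv ℝ A ξ lam, μ⟫_ℝ =
      ∑ a : Fin n × Fin N, ∑ b : Fin n × Fin N,
        dA A ξ a.1 a.2 b.1 b.2 * lam b * μ a := by
  have h : lam = ∑ b, lam b • EuclideanSpace.single b (1 : ℝ) := by
    ext a
    simp [Finset.sum_apply, Pi.single_apply]
  conv_lhs => rw [h]
  simp only [map_sum, map_smul, PiLp.inner_apply, dA]
  refine Finset.sum_congr rfl fun a _ => ?_
  simp [Finset.mul_sum, mul_comm, mul_left_comm]

theorem abs_sum_mul_le {ι : Type*} [Fintype ι] {C : ℝ} {K : ι → ι → ℝ}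
    (hK : ∀ a b, |K a b| ≤ C) (lam μ : EuclideanSpace ℝ ι) :
    |∑ a, ∑ b, K a b * lam b * μ a| ≤ (Fintype.card ι : ℝ) ^ 2 * C * (‖lam‖ * ‖μ‖) := by
  calc |∑ a, ∑ b, K a b * lam b * μ a| ≤ ∑ a, ∑ b, |K a b * lam b * μ a| :=
        (Finset.abs_sum_le_sum_abs _ _).trans
          (Finset.sum_le_sum fun a _ => Finset.abs_sum_le_sum_abs _ _)
    _ ≤ ∑ _a : ι, ∑ _b : ι, C * ‖lam‖ * ‖μ‖ := by
        refine Finset.sum_le_sum fun a _ => Finset.sum_le_sum fun b _ => ?_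
        rw [abs_mul, abs_mul]
        have h₁ : |lam b| ≤ ‖lam‖ := PiLp.norm_apply_le lam b
        have h₂ : |μ a| ≤ ‖μ‖ := PiLp.norm_apply_le μ a
        have hC : 0 ≤ C := (abs_nonneg _).trans (hK a b)
        gcongr
        exact hK a b
    _ = _ := by
        simp only [Finset.sum_const, Finset.card_univ, nsmul_eq_mul]
        ring

theorem abs_inner_fderiv_le {n N : ℕ} {p q m M : ℝ} {A : Vec n N → Vec n N}
    (hA : EllipticGrowth n N p q m M A) (ξ lam μ : Vec n N) :
    |⟪fderiv ℝ A ξ lam, μ⟫_ℝ| ≤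
      ((n * N : ℕ) : ℝ) ^ 2 * (M * (1 + ‖ξ‖ ^ 2) ^ ((q - 2) / 2)) * (‖lam‖ * ‖μ‖) := by
  rw [inner_fderiv_eq_sum]
  simpa using abs_sum_mul_le (fun a b => hA.growth ξ a.1 a.2 b.1 b.2) lam μ

theorem abs_inner_fderiv_sub_le {n N : ℕ} {p q M : ℝ} {A : Vec n N → Vec n N}
    (hA : SkewControl n N p q M A) (ξ lam μ : Vec n N) :
    |⟪fderiv ℝ A ξ lam, μ⟫_ℝ - ⟪fderiv ℝ A ξ μ, lam⟫_ℝ| ≤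
      ((n * N : ℕ) : ℝ) ^ 2 * (M * (1 + ‖ξ‖ ^ 2) ^ ((q + p - 4) / 4)) * (‖lam‖ * ‖μ‖) := by
  have h : ⟪fderiv ℝ A ξ lam, μ⟫_ℝ - ⟪fderiv ℝ A ξ μ, lam⟫_ℝ =
      ∑ a : Fin n × Fin N, ∑ b : Fin n × Fin N,
        (dA A ξ a.1 a.2 b.1 b.2 - dA A ξ b.1 b.2 a.1 a.2) * lam b * μ a := by
    rw [inner_fderiv_eq_sum, inner_fderiv_eq_sum]
    conv_lhs => rw [Finset.sum_comm (f := fun a b => dA A ξ a.1 a.2 b.1 b.2 * μ b * lam a)]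
    simp only [← Finset.sum_sub_distrib]
    exact Finset.sum_congr rfl fun a _ => Finset.sum_congr rfl fun b _ => by ring
  rw [h]
  simpa using abs_sum_mul_le (fun a b => hA ξ a.1 a.2 b.1 b.2) lam μ

theorem le_inner_fderiv {n N : ℕ} {p q m M : ℝ} {A : Vec n N → Vec n N}
    (hA : EllipticGrowth n N p q m M A) (ξ lam : Vec n N) :
    m * (1 + ‖ξ‖ ^ 2) ^ ((p - 2) / 2) * ‖lam‖ ^ 2 ≤ ⟪fderiv ℝ A ξ lam, lam⟫_ℝ := by
  refine (hA.ellipticity ξ lam).trans_eq ?_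
  rw [inner_fderiv_eq_sum]
  simp only [Fintype.sum_prod_type]
  refine Finset.sum_congr rfl fun i _ => ?_
  rw [Finset.sum_comm]
  exact Finset.sum_congr rfl fun α _ => Finset.sum_congr rfl fun j _ =>
    Finset.sum_congr rfl fun β _ => by ring

/-- A Caccioppoli-type absorption inequality for a linear map which is coercive, bounded, and
whose skew part is controlled by the geometric mean of the two constants. -/
theorem coercive_absorption {E : Type*} [NormedAddCommGroup E] [InnerProductSpace ℝ E]
    (B : E →L[ℝ] E) {a b k κ : ℝ} (ha : 0 < a)
    (hcoer : ∀ v, a * ‖v‖ ^ 2 ≤ ⟪B v, v⟫_ℝ)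
    (hbdd : ∀ v w, |⟪B v, w⟫_ℝ| ≤ b * (‖v‖ * ‖w‖))
    (hskew : ∀ v w, |⟪B v, w⟫_ℝ - ⟪B w, v⟫_ℝ| ≤ k * (‖v‖ * ‖w‖))
    (hk : k ^ 2 = κ * a * b) (t : ℝ) (v w : E) :
    a / 4 * (t ^ 2 * ‖v‖ ^ 2) ≤
      ⟪B v, t ^ 2 • v + (2 * t) • w⟫_ℝ + (2 + κ) * b * ‖w‖ ^ 2 := by
  have hpos := (mul_nonneg ha.le (sq_nonneg ‖t • v + (2 : ℝ) • w‖)).trans (hcoer _)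
  have h₁ := mul_le_mul_of_nonneg_left (hcoer v) (sq_nonneg t)
  have h₂ := (le_abs_self _).trans (hbdd w w)
  have h₃ : -(t * (⟪B v, w⟫_ℝ - ⟪B w, v⟫_ℝ)) ≤
      a / 4 * (t ^ 2 * ‖v‖ ^ 2) + κ * b * ‖w‖ ^ 2 := by
    calc -(t * (⟪B v, w⟫_ℝ - ⟪B w, v⟫_ℝ)) ≤ |t| * |⟪B v, w⟫_ℝ - ⟪B w, v⟫_ℝ| := by
          rw [← abs_mul]; exact neg_le_abs _
      _ ≤ |t| * (k * (‖v‖ * ‖w‖)) := by gcongr; exact hskew v w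
      _ ≤ _ := by
          have hs := sq_nonneg (a / 2 * (|t| * ‖v‖) - k * ‖w‖)
          refine le_of_mul_le_mul_left ?_ ha
          have : |t| ^ 2 = t ^ 2 := sq_abs t
          rw [← this]
          linear_combination hs + ‖w‖ ^ 2 * hk
  simp only [map_add, map_smul, inner_add_left, inner_add_right, real_inner_smul_left,
    real_inner_smul_right] at hpos ⊢
  linarith

theorem norm_fderiv_Vmap_comp_sq_le {n N : ℕ} (p : ℝ) {g : Pt n → Vec n N} {x : Pt n}
    (hg : DifferentiableAt ℝ g x) (v : Pt n) :
    ‖fderiv ℝ (fun y => Vmap p (g y)) x v‖ ^ 2 ≤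
      (1 + |p - 2| / 2) ^ 2 * ((1 + ‖g x‖ ^ 2) ^ ((p - 2) / 2) * ‖fderiv ℝ g x v‖ ^ 2) := by
  set w := 1 + ‖g x‖ ^ 2 with hw
  set r := (p - 2) / 4 with hr
  have hw0 : 0 < w := by positivity
  have hd := hg.hasFDerivAt
  have hnorm := (hd.norm_sq).const_add 1
  have hV := (hnorm.rpow_const (p := r) (Or.inl hw0.ne')).smul hd
  have hfd : fderiv ℝ (fun y => Vmap p (g y)) x v =
      w ^ r • fderiv ℝ g x v + (r * w ^ (r - 1) * (2 * ⟪g x, fderiv ℝ g x v⟫_ℝ)) • g x := by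
    have := hV.fderiv
    simp only [Vmap]
    rw [show (fun y => (1 + ‖g y‖ ^ 2) ^ ((p - 2) / 4) • g y) =
      (fun y => (1 + ‖g y‖ ^ 2) ^ r) • g from rfl, this]
    simp [hw, mul_assoc]
  set l := fderiv ℝ g x v
  have hle : ‖fderiv ℝ (fun y => Vmap p (g y)) x v‖ ≤ (1 + |p - 2| / 2) * (w ^ r * ‖l‖) := by
    rw [hfd]
    refine (norm_add_le _ _).trans ?_
    rw [norm_smul, norm_smul, Real.norm_of_nonneg (by positivity), Real.norm_eq_abs, abs_mul,
      abs_mul, abs_mul, abs_two, abs_of_nonneg (by positivity : 0 ≤ w ^ (r - 1))]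
    have h1 := abs_real_inner_le_norm (g x) l
    have h2 : w ^ r = w ^ (r - 1) * w := by
      rw [← Real.rpow_add_one hw0.ne']; ring_nf
    have h3 : |r| = |p - 2| / 4 := by rw [hr, abs_div]; norm_num
    have h4 : ‖g x‖ * ‖g x‖ ≤ w := by rw [hw]; nlinarith
    calc w ^ r * ‖l‖ + |r| * w ^ (r - 1) * (2 * |⟪g x, l⟫_ℝ|) * ‖g x‖
        ≤ w ^ r * ‖l‖ + |r| * w ^ (r - 1) * (2 * (‖g x‖ * ‖l‖)) * ‖g x‖ := by gcongr
      _ = w ^ r * ‖l‖ + 2 * |r| * (w ^ (r - 1) * (‖g x‖ * ‖g x‖)) * ‖l‖ := by ring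
      _ ≤ w ^ r * ‖l‖ + 2 * |r| * (w ^ (r - 1) * w) * ‖l‖ := by gcongr
      _ = _ := by rw [← h2, h3]; ring
  calc _ ≤ ((1 + |p - 2| / 2) * (w ^ r * ‖l‖)) ^ 2 := by gcongr
    _ = (1 + |p - 2| / 2) ^ 2 * ((w ^ r) ^ 2 * ‖l‖ ^ 2) := by ring
    _ = _ := by
      rw [← Real.rpow_natCast (w ^ r) 2, ← Real.rpow_mul hw0.le, hr]
      norm_num
      ring_nf
      simp

/-- The linear map sending the derivative of a map to its array of partial derivatives. -/
def gradCLM (n N : ℕ) : (Pt n →L[ℝ] EuclideanSpace ℝ (Fin N)) →L[ℝ] Vec n N :=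
  LinearMap.toContinuousLinearMap
    { toFun := fun L => WithLp.toLp 2 fun a => L (EuclideanSpace.single a.1 1) a.2
      map_add' := fun _ _ => by ext; simp
      map_smul' := fun _ _ => by ext; simp }

theorem grad_eq_gradCLM {n N : ℕ} (u : Pt n → EuclideanSpace ℝ (Fin N)) (x : Pt n) :
    grad u x = gradCLM n N (fderiv ℝ u x) := rfl

theorem grad_apply {n N : ℕ} (u : Pt n → EuclideanSpace ℝ (Fin N)) (x : Pt n)
    (a : Fin n × Fin N) : grad u x a = fderiv ℝ u x (EuclideanSpace.single a.1 1) a.2 := rfl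

theorem norm_fderiv_single_le_norm_grad {n N : ℕ} (u : Pt n → EuclideanSpace ℝ (Fin N))
    (x : Pt n) (s : Fin n) :
    ‖fderiv ℝ u x (EuclideanSpace.single s 1)‖ ≤ ‖grad u x‖ := by
  rw [EuclideanSpace.norm_eq, EuclideanSpace.norm_eq]
  refine Real.sqrt_le_sqrt ?_
  rw [Fintype.sum_prod_type]
  exact Finset.single_le_sum
    (f := fun i => ∑ α, ‖grad u x (i, α)‖ ^ 2)
    (fun i _ => Finset.sum_nonneg fun _ _ => sq_nonneg _) (Finset.mem_univ s)

theorem contDiffAt_grad {n N : ℕ} {u : Pt n → EuclideanSpace ℝ (Fin N)} {x : Pt n}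
    (hu : ContDiffAt ℝ 2 u x) : ContDiffAt ℝ 1 (grad u) x :=
  (gradCLM n N).contDiff.contDiffAt.comp x (hu.fderiv_right (m := 1) (by norm_num))

theorem grad_fderiv_apply {n N : ℕ} {u : Pt n → EuclideanSpace ℝ (Fin N)} {x : Pt n}
    (hu : ContDiffAt ℝ 2 u x) (v : Pt n) :
    grad (fun y => fderiv ℝ u y v) x = fderiv ℝ (grad u) x v := by
  have hd : DifferentiableAt ℝ (fderiv ℝ u) x :=
    (hu.fderiv_right (m := 1) (by norm_num)).differentiableAt (by norm_num)
  have h : fderiv ℝ (grad u) x = (gradCLM n N).comp (fderiv ℝ (fderiv ℝ u) x) :=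
    ((gradCLM n N).hasFDerivAt.comp x hd.hasFDerivAt).fderiv
  have hsymm : IsSymmSndFDerivAt ℝ u x := hu.isSymmSndFDerivAt (by simp)
  rw [h, ContinuousLinearMap.comp_apply]
  ext a
  rw [grad_apply, fderiv_clm_apply hd (differentiableAt_const v)]
  simp only [fderiv_fun_const, Pi.zero_apply, ContinuousLinearMap.comp_zero, zero_add,
    ContinuousLinearMap.flip_apply]
  rw [hsymm]
  rfl

theorem grad_eq_zero_of_notMem_tsupport {n N : ℕ} {ψ : Pt n → EuclideanSpace ℝ (Fin N)}
    {x : Pt n} (hx : x ∉ tsupport ψ) : grad ψ x = 0 := by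
  rw [grad_eq_gradCLM, fderiv_of_notMem_tsupport ℝ hx, map_zero]

theorem integrable_of_bounded_on_compact {X : Type*} [TopologicalSpace X] [MeasurableSpace X]
    [OpensMeasurableSpace X] [T2Space X] {μ : Measure X} [IsFiniteMeasureOnCompacts μ]
    {f : X → ℝ} {K : Set X}
    (hf : AEStronglyMeasurable f μ) (hK : IsCompact K) {C : ℝ} (hC : ∀ x ∈ K, ‖f x‖ ≤ C)
    (h0 : ∀ x ∉ K, f x = 0) : Integrable f μ := by
  have h : IntegrableOn f K μ :=
    Measure.integrableOn_of_bounded hK.measure_lt_top.ne hf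
      (ae_restrict_of_forall_mem hK.measurableSet hC)
  exact h.integrable_of_forall_notMem_eq_zero h0

theorem integral_fderiv_eq_zero_of_integrable {E : Type*} [NormedAddCommGroup E]
    [NormedSpace ℝ E] [FiniteDimensional ℝ E] [MeasurableSpace E] [BorelSpace E]
    {μ : Measure E} [μ.IsAddHaarMeasure] {f : E → ℝ} {v : E} (hf : Differentiable ℝ f)
    (hi : Integrable f μ) (hi' : Integrable (fun x => fderiv ℝ f x v) μ) :
    ∫ x, fderiv ℝ f x v ∂μ = 0 := by
  have h := integral_mul_fderiv_eq_neg_fderiv_mul_of_integrable (μ := μ) (f := f)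
    (g := fun _ => (1 : ℝ)) (v := v) (by simpa using hi') (by simp) (by simpa using hi)
    (fun x _ => hf x) (fun x _ => differentiableAt_const _)
  simpa using h.symm

theorem fderiv_comp_grad_apply {n N : ℕ} {A : Vec n N → Vec n N} (hA : Differentiable ℝ A)
    {u : Pt n → EuclideanSpace ℝ (Fin N)} {x : Pt n} (hu : ContDiffAt ℝ 2 u x) (v : Pt n) :
    fderiv ℝ (fun y => A (grad u y)) x v =
      fderiv ℝ A (grad u x) (fderiv ℝ (grad u) x v) := by
  have hd := (contDiffAt_grad hu).differentiableAt (by norm_num)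
  exact congrArg (fun L => L v) (((hA (grad u x)).hasFDerivAt.comp x hd.hasFDerivAt).fderiv)

theorem continuous_grad {n N : ℕ} {ψ : Pt n → EuclideanSpace ℝ (Fin N)}
    (hψ : ContDiff ℝ 1 ψ) : Continuous (grad ψ) :=
  (gradCLM n N).continuous.comp (hψ.continuous_fderiv (by norm_num))

theorem integrable_inner_fderiv_grad {n N : ℕ} {G : Pt n → Vec n N} {Ω : Set (Pt n)} {v : Pt n}
    (hGb : ∀ K ⊆ Ω, IsCompact K → ∃ C, ∀ x ∈ K, ‖fderiv ℝ G x v‖ ≤ C)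
    {ψ : Pt n → EuclideanSpace ℝ (Fin N)} (hψ : ContDiff ℝ 1 ψ) (hc : HasCompactSupport ψ)
    (hs : tsupport ψ ⊆ Ω) : Integrable fun x => ⟪fderiv ℝ G x v, grad ψ x⟫_ℝ := by
  obtain ⟨C, hC⟩ := hGb _ hs hc
  obtain ⟨C', hC'⟩ := hc.isCompact.exists_bound_of_continuousOn (continuous_grad hψ).continuousOn
  refine integrable_of_bounded_on_compact (C := C * C') ?_ hc.isCompact (fun x hx => ?_)
    (fun x hx => ?_)
  · exact ((measurable_fderiv_apply_const ℝ G v).aestronglyMeasurable).inner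
      (continuous_grad hψ).aestronglyMeasurable
  · refine (norm_inner_le_norm _ _).trans ?_
    exact mul_le_mul (hC x hx) (hC' x hx) (norm_nonneg _) ((norm_nonneg _).trans (hC x hx))
  · rw [grad_eq_zero_of_notMem_tsupport hx, inner_zero_right]

/-- The differentiated equation, for smooth test functions. -/
theorem integral_inner_fderiv_grad_eq_zero_of_smooth {n N : ℕ} {G : Pt n → Vec n N}
    {Ω : Set (Pt n)} {v : Pt n} (hG : ∀ x ∈ Ω, DifferentiableAt ℝ G x)
    (hGb : ∀ K ⊆ Ω, IsCompact K → ∃ C, ∀ x ∈ K, ‖fderiv ℝ G x v‖ ≤ C)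
    (hweak : ∀ φ : Pt n → EuclideanSpace ℝ (Fin N), ContDiff ℝ (⊤ : ℕ∞) φ →
      HasCompactSupport φ → tsupport φ ⊆ Ω → ∫ x in Ω, ⟪G x, grad φ x⟫_ℝ = 0)
    {ψ : Pt n → EuclideanSpace ℝ (Fin N)} (hψ : ContDiff ℝ (⊤ : ℕ∞) ψ)
    (hc : HasCompactSupport ψ) (hs : tsupport ψ ⊆ Ω) :
    ∫ x, ⟪fderiv ℝ G x v, grad ψ x⟫_ℝ = 0 := by
  set φ : Pt n → EuclideanSpace ℝ (Fin N) := fun y => fderiv ℝ ψ y v with hφ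
  have hφsm : ContDiff ℝ (⊤ : ℕ∞) φ :=
    (hψ.fderiv_right (m := (⊤ : ℕ∞)) (by norm_cast)).clm_apply contDiff_const
  have hφsub : tsupport φ ⊆ tsupport ψ := tsupport_fderiv_apply_subset ℝ v
  have hφc : HasCompactSupport φ := hc.fderiv_apply ℝ v
  have hψ2 : ContDiff ℝ 2 ψ := hψ.of_le (by norm_cast)
  have hψ1 : ContDiff ℝ 1 ψ := hψ.of_le (by norm_cast)
  have hφ1 : ContDiff ℝ 1 φ := hφsm.of_le (by norm_cast)
  have hzero : ∀ {χ : Pt n → EuclideanSpace ℝ (Fin N)} {x}, x ∉ tsupport χ →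
      ⟪G x, grad χ x⟫_ℝ = 0 := fun hx => by
    rw [grad_eq_zero_of_notMem_tsupport hx, inner_zero_right]
  have hint : ∀ {χ : Pt n → EuclideanSpace ℝ (Fin N)}, ContDiff ℝ 1 χ →
      HasCompactSupport χ → tsupport χ ⊆ Ω → Integrable fun x => ⟪G x, grad χ x⟫_ℝ := by
    intro χ hχ hχc hχs
    have hsub : tsupport (fun x => ⟪G x, grad χ x⟫_ℝ) ⊆ tsupport χ :=
      closure_minimal (fun x hx => by_contra fun h => hx (hzero h)) (isClosed_tsupport χ)
    refine Continuous.integrable_of_hasCompactSupport (continuous_of_tsupport fun x hx => ?_)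
      (hχc.isCompact.of_isClosed_subset (isClosed_tsupport _) hsub)
    exact (hG x (hχs (hsub hx))).continuousAt.inner (continuous_grad hχ).continuousAt
  set f : Pt n → ℝ := fun x => ⟪G x, grad ψ x⟫_ℝ with hf
  have hder : ∀ x, HasFDerivAt f (fderiv ℝ f x) x ∧
      fderiv ℝ f x v = ⟪G x, grad φ x⟫_ℝ + ⟪fderiv ℝ G x v, grad ψ x⟫_ℝ := by
    intro x
    by_cases hx : x ∈ tsupport ψ
    · have hgd := ((contDiffAt_grad hψ2.contDiffAt (x := x)).differentiableAt
        (by norm_num)).hasFDerivAt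
      have h := (hG x (hs hx)).hasFDerivAt.inner ℝ hgd
      refine ⟨h.differentiableAt.hasFDerivAt, ?_⟩
      rw [h.fderiv, hφ, grad_fderiv_apply hψ2.contDiffAt]
      simp
    · have h0 : f =ᶠ[𝓝 x] fun _ => 0 := by
        filter_upwards [(isClosed_tsupport ψ).isOpen_compl.mem_nhds hx] with y hy
        exact hzero hy
      have h : HasFDerivAt f (0 : Pt n →L[ℝ] ℝ) x :=
        (hasFDerivAt_const (0 : ℝ) x).congr_of_eventuallyEq h0
      refine ⟨h.differentiableAt.hasFDerivAt, ?_⟩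
      rw [h.fderiv, grad_eq_zero_of_notMem_tsupport hx,
        grad_eq_zero_of_notMem_tsupport fun h' => hx (hφsub h')]
      simp
  have hi1 := hint hφ1 hφc (hφsub.trans hs)
  have hi2 := integrable_inner_fderiv_grad hGb hψ1 hc hs
  have hderv : (fun x => fderiv ℝ f x v) =
      fun x => ⟪G x, grad φ x⟫_ℝ + ⟪fderiv ℝ G x v, grad ψ x⟫_ℝ := funext fun x => (hder x).2
  have hmain := integral_fderiv_eq_zero_of_integrable (v := v)
    (fun x => (hder x).1.differentiableAt) (hint hψ1 hc hs) (hderv ▸ hi1.add hi2)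
  rw [hderv, integral_add hi1 hi2] at hmain
  have hw := hweak φ hφsm hφc (hφsub.trans hs)
  rw [setIntegral_eq_integral_of_forall_compl_eq_zero
    fun x hx => hzero fun h' => hx (hs (hφsub h'))] at hw
  rwa [hw, zero_add] at hmain

/-- Smooth approximation of a `C¹` compactly supported map, with supports in a fixed compact
subset of a given open set. -/
theorem exists_smooth_approximation {E F : Type*} [NormedAddCommGroup E] [InnerProductSpace ℝ E]
    [FiniteDimensional ℝ E] [MeasurableSpace E] [BorelSpace E] [NormedAddCommGroup F]
    [NormedSpace ℝ F] [CompleteSpace F] {ψ : E → F} {Ω : Set E} (hΩ : IsOpen Ω)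
    (hψ : ContDiff ℝ 1 ψ) (hc : HasCompactSupport ψ) (hs : tsupport ψ ⊆ Ω) :
    ∃ (K : Set E) (C : ℝ) (Ψ : ℕ → E → F), IsCompact K ∧ K ⊆ Ω ∧
      (∀ k, ContDiff ℝ (⊤ : ℕ∞) (Ψ k)) ∧ (∀ k, tsupport (Ψ k) ⊆ K) ∧
      (∀ k x, ‖fderiv ℝ (Ψ k) x‖ ≤ C) ∧
      ∀ x, Tendsto (fun k => fderiv ℝ (Ψ k) x) atTop (𝓝 (fderiv ℝ ψ x)) := by
  obtain ⟨δ, hδ, hδΩ⟩ := hc.isCompact.exists_cthickening_subset_open hΩ hs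
  obtain ⟨C, hC⟩ := (hc.fderiv ℝ).exists_bound_of_continuous (hψ.continuous_fderiv (by norm_num))
  have hpos : ∀ k : ℕ, 0 < δ / ((k : ℝ) + 1) := fun k => by positivity
  let bump : ℕ → ContDiffBump (0 : E) := fun k =>
    ⟨δ / ((k : ℝ) + 1) / 2, δ / ((k : ℝ) + 1), half_pos (hpos k), half_lt_self (hpos k)⟩
  have hout : Tendsto (fun k => (bump k).rOut) atTop (𝓝 0) :=
    tendsto_const_nhds.div_atTop
      (tendsto_atTop_add_const_right _ 1 tendsto_natCast_atTop_atTop)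
  let Ψ : ℕ → E → F := fun k =>
    convolution ((bump k).normed volume) ψ (ContinuousLinearMap.lsmul ℝ ℝ) volume
  have hfd : ∀ k x, fderiv ℝ (Ψ k) x =
      convolution ((bump k).normed volume) (fderiv ℝ ψ) (ContinuousLinearMap.lsmul ℝ ℝ) volume x :=
    fun k x => by
      rw [(hc.hasFDerivAt_convolution_right (ContinuousLinearMap.lsmul ℝ ℝ)
        ((bump k).continuous_normed.locallyIntegrable) hψ x).fderiv]
      rfl
  refine ⟨Metric.cthickening δ (tsupport ψ), C, Ψ, hc.isCompact.cthickening, hδΩ,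
    fun k => ?_, fun k => ?_, fun k x => ?_, fun x => ?_⟩
  · exact (bump k).hasCompactSupport_normed.contDiff_convolution_left _
      (bump k).contDiff_normed hψ.continuous.locallyIntegrable
  · refine closure_minimal ?_ Metric.isClosed_cthickening
    refine (support_convolution_subset_swap
      (ContinuousLinearMap.lsmul ℝ ℝ : ℝ →L[ℝ] F →L[ℝ] F)).trans ?_
    rintro _ ⟨y, hy, z, hz, rfl⟩
    refine Metric.mem_cthickening_of_dist_le _ y _ _ (subset_tsupport _ hy) ?_
    rw [(bump k).support_normed_eq] at hz
    have hz' : ‖z‖ < δ / ((k : ℝ) + 1) := mem_ball_zero_iff.1 hz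
    have : δ / ((k : ℝ) + 1) ≤ δ := div_le_self hδ.le (by linarith [k.cast_nonneg (α := ℝ)])
    simpa using hz'.le.trans this
  · rw [hfd, ← dist_zero_right]
    exact dist_convolution_le ((norm_nonneg _).trans (hC 0)) (bump k).support_normed_eq.subset
      (bump k).nonneg_normed (bump k).integral_normed
      (hψ.continuous_fderiv (by norm_num)).aestronglyMeasurable
      fun y _ => by simpa using hC y
  · simp only [hfd]
    exact ContDiffBump.convolution_tendsto_right_of_continuous hout
      (hψ.continuous_fderiv (by norm_num)) x

/-- The differentiated equation, for `C¹` test functions. -/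
theorem integral_inner_fderiv_grad_eq_zero {n N : ℕ} {G : Pt n → Vec n N}
    {Ω : Set (Pt n)} (hΩ : IsOpen Ω) {v : Pt n} (hG : ∀ x ∈ Ω, DifferentiableAt ℝ G x)
    (hGb : ∀ K ⊆ Ω, IsCompact K → ∃ C, ∀ x ∈ K, ‖fderiv ℝ G x v‖ ≤ C)
    (hweak : ∀ φ : Pt n → EuclideanSpace ℝ (Fin N), ContDiff ℝ (⊤ : ℕ∞) φ →
      HasCompactSupport φ → tsupport φ ⊆ Ω → ∫ x in Ω, ⟪G x, grad φ x⟫_ℝ = 0)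
    {ψ : Pt n → EuclideanSpace ℝ (Fin N)} (hψ : ContDiff ℝ 1 ψ)
    (hc : HasCompactSupport ψ) (hs : tsupport ψ ⊆ Ω) :
    ∫ x, ⟪fderiv ℝ G x v, grad ψ x⟫_ℝ = 0 := by
  obtain ⟨K, C, Ψ, hK, hKΩ, hsm, hsupp, hbd, hlim⟩ := exists_smooth_approximation hΩ hψ hc hs
  obtain ⟨C', hC'⟩ := hGb K hKΩ hK
  have hcΨ : ∀ k, HasCompactSupport (Ψ k) := fun k =>
    hK.of_isClosed_subset (isClosed_tsupport _) (hsupp k)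
  have hint : ∀ k, Integrable fun x => ⟪fderiv ℝ G x v, grad (Ψ k) x⟫_ℝ := fun k =>
    integrable_inner_fderiv_grad hGb ((hsm k).of_le (by norm_cast)) (hcΨ k)
      ((hsupp k).trans hKΩ)
  have htends := tendsto_integral_of_dominated_convergence (μ := volume)
    (F := fun k x => ⟪fderiv ℝ G x v, grad (Ψ k) x⟫_ℝ)
    (f := fun x => ⟪fderiv ℝ G x v, grad ψ x⟫_ℝ)
    (K.indicator fun _ => C' * (‖gradCLM n N‖ * C)) (fun k => (hint k).aestronglyMeasurable)
    ((integrable_indicator_iff hK.measurableSet).2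
      (integrableOn_const hK.measure_lt_top.ne))
    (fun k => Eventually.of_forall fun x => ?_) (Eventually.of_forall fun x => ?_)
  · simp only [integral_inner_fderiv_grad_eq_zero_of_smooth hG hGb hweak (hsm _) (hcΨ _)
      ((hsupp _).trans hKΩ)] at htends
    exact tendsto_nhds_unique htends tendsto_const_nhds
  · by_cases hx : x ∈ K
    · rw [Set.indicator_of_mem hx]
      refine (norm_inner_le_norm _ _).trans (mul_le_mul (hC' x hx) ?_ (norm_nonneg _)
        ((norm_nonneg _).trans (hC' x hx)))
      exact ((gradCLM n N).le_opNorm _).trans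
        (mul_le_mul_of_nonneg_left (hbd k x) (norm_nonneg _))
    · rw [Set.indicator_of_notMem hx,
        grad_eq_zero_of_notMem_tsupport fun h => hx (hsupp k h), inner_zero_right, norm_zero]
  · exact tendsto_const_nhds.inner (((gradCLM n N).continuous.tendsto _).comp (hlim x))

theorem exists_bound_fderiv_comp_grad {n N : ℕ} {p q m M : ℝ} {A : Vec n N → Vec n N}
    (hA : EllipticGrowth n N p q m M A) {Ω : Set (Pt n)} (hΩ : IsOpen Ω)
    {u : Pt n → EuclideanSpace ℝ (Fin N)} (hu : ContDiffOn ℝ 2 u Ω) (v : Pt n)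
    {K : Set (Pt n)} (hKΩ : K ⊆ Ω) (hK : IsCompact K) :
    ∃ C, ∀ x ∈ K, ‖fderiv ℝ (fun y => A (grad u y)) x v‖ ≤ C := by
  have hg : ∀ x ∈ K, ContDiffAt ℝ 1 (grad u) x := fun x hx =>
    contDiffAt_grad (hu.contDiffAt (hΩ.mem_nhds (hKΩ hx)))
  set b : Pt n → ℝ := fun x =>
    ((n * N : ℕ) : ℝ) ^ 2 * (M * (1 + ‖grad u x‖ ^ 2) ^ ((q - 2) / 2)) *
      ‖fderiv ℝ (grad u) x v‖ with hb
  have hcont : ContinuousOn b K := fun x hx => by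
    refine ContinuousAt.continuousWithinAt ?_
    have h1 : ContinuousAt (fun x => 1 + ‖grad u x‖ ^ 2) x :=
      continuousAt_const.add ((hg x hx).continuousAt.norm.pow 2)
    have h2 : ContinuousAt (fun y => fderiv ℝ (grad u) y v) x :=
      (((hg x hx).fderiv_right (m := 0) (by norm_num)).continuousAt).clm_apply continuousAt_const
    exact (continuousAt_const.mul (continuousAt_const.mul
      (h1.rpow_const (Or.inl (by positivity))))).mul h2.norm
  obtain ⟨C, hC⟩ := hK.exists_bound_of_continuousOn hcont
  refine ⟨C, fun x hx => ?_⟩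
  have hbC := hC x hx
  rw [fderiv_comp_grad_apply hA.differentiable (hu.contDiffAt (hΩ.mem_nhds (hKΩ hx)))]
  set l := fderiv ℝ A (grad u x) (fderiv ℝ (grad u) x v) with hl
  rcases (norm_nonneg l).eq_or_lt with h0 | h0
  · exact h0 ▸ (norm_nonneg _).trans hbC
  · have h1 := (le_abs_self _).trans
      (abs_inner_fderiv_le hA (grad u x) (fderiv ℝ (grad u) x v) l)
    rw [← hl, real_inner_self_eq_norm_sq, sq, ← mul_assoc] at h1
    exact (le_of_mul_le_mul_right h1 h0).trans ((le_abs_self _).trans hbC)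

theorem grad_sq_smul_fderiv_apply {n N : ℕ} {u : Pt n → EuclideanSpace ℝ (Fin N)}
    {η : Pt n → ℝ} {x : Pt n} (hu : ContDiffAt ℝ 2 u x) (hη : DifferentiableAt ℝ η x)
    (v : Pt n) :
    grad (fun y => η y ^ 2 • fderiv ℝ u y v) x =
      η x ^ 2 • fderiv ℝ (grad u) x v +
        (2 * η x) • gradCLM n N ((fderiv ℝ η x).smulRight (fderiv ℝ u x v)) := by
  have hd : DifferentiableAt ℝ (fun y => fderiv ℝ u y v) x :=
    ((hu.fderiv_right (m := 1) (by norm_num)).differentiableAt (by norm_num)).clm_apply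
      (differentiableAt_const v)
  have h := ((hη.hasFDerivAt.pow 2).smul hd.hasFDerivAt).fderiv
  rw [← grad_fderiv_apply hu, grad_eq_gradCLM, grad_eq_gradCLM, ← map_smul, ← map_smul, ← map_add]
  congr 1
  refine h.trans ?_
  ext w
  simp [mul_smul]

theorem norm_gradCLM_smulRight_sq_le {n N : ℕ} (u : Pt n → EuclideanSpace ℝ (Fin N))
    (ℓ : Pt n →L[ℝ] ℝ) (x : Pt n) (s : Fin n) :
    ‖gradCLM n N (ℓ.smulRight (fderiv ℝ u x (EuclideanSpace.single s 1)))‖ ^ 2 ≤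
      ‖gradCLM n N‖ ^ 2 * (‖ℓ‖ ^ 2 * (1 + ‖grad u x‖ ^ 2)) := by
  have h := (gradCLM n N).le_opNorm
    (ℓ.smulRight (fderiv ℝ u x (EuclideanSpace.single s 1)))
  rw [ContinuousLinearMap.norm_smulRight_apply] at h
  have h' := norm_fderiv_single_le_norm_grad u x s
  calc _ ≤ (‖gradCLM n N‖ * (‖ℓ‖ * ‖grad u x‖)) ^ 2 := by
        gcongr
        exact h.trans (by gcongr)
    _ = ‖gradCLM n N‖ ^ 2 * (‖ℓ‖ ^ 2 * ‖grad u x‖ ^ 2) := by ring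
    _ ≤ _ := by gcongr; linarith

/-- The pointwise form of the estimate, in one direction of differentiation. -/
theorem norm_fderiv_Vmap_grad_sq_mul_le {n N : ℕ} {p q m M : ℝ} (hm : 0 < m) (hM : 0 < M)
    {A : Vec n N → Vec n N} (hA : EllipticGrowth n N p q m M A) (hskew : SkewControl n N p q M A)
    {u : Pt n → EuclideanSpace ℝ (Fin N)} {η : Pt n → ℝ} {x : Pt n}
    (hu : ContDiffAt ℝ 2 u x) (hη : DifferentiableAt ℝ η x) (s : Fin n) :
    ‖fderiv ℝ (fun y => Vmap p (grad u y)) x (EuclideanSpace.single s 1)‖ ^ 2 * η x ^ 2 ≤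
      (1 + |p - 2| / 2) ^ 2 * (4 / m) *
        (⟪fderiv ℝ (fun y => A (grad u y)) x (EuclideanSpace.single s 1),
          grad (fun y => η y ^ 2 • fderiv ℝ u y (EuclideanSpace.single s 1)) x⟫_ℝ +
        (2 + ((n * N : ℕ) : ℝ) ^ 2 * M / m) * (((n * N : ℕ) : ℝ) ^ 2 * M) *
          ‖gradCLM n N‖ ^ 2 * ((1 + ‖grad u x‖ ^ 2) ^ (q / 2) * ‖fderiv ℝ η x‖ ^ 2)) := by
  set e : Pt n := EuclideanSpace.single s 1
  set w := 1 + ‖grad u x‖ ^ 2 with hw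
  have hw0 : 0 < w := by positivity
  set D := ((n * N : ℕ) : ℝ) ^ 2 with hD
  have hD0 : 0 ≤ D := by positivity
  set lam := fderiv ℝ (grad u) x e
  set μ := gradCLM n N ((fderiv ℝ η x).smulRight (fderiv ℝ u x e)) with hμ
  have hd : DifferentiableAt ℝ (grad u) x := (contDiffAt_grad hu).differentiableAt (by norm_num)
  have hk : (D * (M * w ^ ((q + p - 4) / 4))) ^ 2 =
      D * M / m * (m * w ^ ((p - 2) / 2)) * (D * (M * w ^ ((q - 2) / 2))) := by
    have h : (w ^ ((q + p - 4) / 4)) ^ 2 = w ^ ((p - 2) / 2) * w ^ ((q - 2) / 2) := by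
      rw [← Real.rpow_natCast, ← Real.rpow_mul hw0.le, ← Real.rpow_add hw0]
      congr 1
      push_cast
      ring
    rw [mul_pow, mul_pow, h]
    field_simp
  have habs := coercive_absorption (fderiv ℝ A (grad u x))
    (mul_pos hm (Real.rpow_pos_of_pos hw0 ((p - 2) / 2)))
    (le_inner_fderiv hA (grad u x)) (abs_inner_fderiv_le hA (grad u x))
    (abs_inner_fderiv_sub_le hskew (grad u x)) hk (η x) lam μ
  have hV := norm_fderiv_Vmap_comp_sq_le p hd e
  have hμ2 : w ^ ((q - 2) / 2) * ‖μ‖ ^ 2 ≤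
      ‖gradCLM n N‖ ^ 2 * (w ^ (q / 2) * ‖fderiv ℝ η x‖ ^ 2) := by
    have h : w ^ (q / 2) = w ^ ((q - 2) / 2) * w := by
      rw [← Real.rpow_add_one hw0.ne']
      ring_nf
    calc _ ≤ w ^ ((q - 2) / 2) * (‖gradCLM n N‖ ^ 2 * (‖fderiv ℝ η x‖ ^ 2 * w)) := by
          gcongr
          exact norm_gradCLM_smulRight_sq_le u _ x s
      _ = _ := by rw [h]; ring
  rw [grad_sq_smul_fderiv_apply hu hη, fderiv_comp_grad_apply hA.differentiable hu]
  set P := (1 + |p - 2| / 2) ^ 2 with hP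
  calc _ ≤ P * (w ^ ((p - 2) / 2) * ‖lam‖ ^ 2) * η x ^ 2 := by gcongr
    _ = P * (4 / m) * (m * w ^ ((p - 2) / 2) / 4 * (η x ^ 2 * ‖lam‖ ^ 2)) := by field_simp
    _ ≤ P * (4 / m) * (⟪fderiv ℝ A (grad u x) lam, η x ^ 2 • lam + (2 * η x) • μ⟫_ℝ +
          (2 + D * M / m) * (D * M) * (w ^ ((q - 2) / 2) * ‖μ‖ ^ 2)) := by
        gcongr
        linarith
    _ ≤ _ := by
        rw [mul_assoc _ (‖gradCLM n N‖ ^ 2)]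
        gcongr

theorem contDiff_sq_smul_fderiv_apply {n N : ℕ} {u : Pt n → EuclideanSpace ℝ (Fin N)}
    {η : Pt n → ℝ} {Ω : Set (Pt n)} (hΩ : IsOpen Ω) (hu : ContDiffOn ℝ 2 u Ω)
    (hη : ContDiff ℝ 1 η) (hs : tsupport η ⊆ Ω) (v : Pt n) :
    ContDiff ℝ 1 (fun y => η y ^ 2 • fderiv ℝ u y v) ∧
      tsupport (fun y => η y ^ 2 • fderiv ℝ u y v) ⊆ tsupport η := by
  have hsub : tsupport (fun y => η y ^ 2 • fderiv ℝ u y v) ⊆ tsupport η := by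
    refine closure_mono fun y hy h => hy ?_
    simp [h]
  refine ⟨contDiff_iff_contDiffAt.2 fun x => ?_, hsub⟩
  by_cases hx : x ∈ tsupport fun y => η y ^ 2 • fderiv ℝ u y v
  swap
  · exact contDiffAt_const.congr_of_eventuallyEq (notMem_tsupport_iff_eventuallyEq.1 hx)
  exact (hη.contDiffAt.pow 2).smul
    (((hu.contDiffAt (hΩ.mem_nhds (hs (hsub hx)))).fderiv_right (m := 1) (by norm_num)).clm_apply
      contDiffAt_const)

theorem integrable_growth_mul_fderiv_sq {n N : ℕ} (q : ℝ) {u : Pt n → EuclideanSpace ℝ (Fin N)}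
    {η : Pt n → ℝ} {Ω : Set (Pt n)} (hΩ : IsOpen Ω) (hu : ContDiffOn ℝ 2 u Ω)
    (hη : ContDiff ℝ 1 η) (hc : HasCompactSupport η) (hs : tsupport η ⊆ Ω) :
    Integrable fun x => (1 + ‖grad u x‖ ^ 2) ^ (q / 2) * ‖fderiv ℝ η x‖ ^ 2 := by
  have hsub : tsupport (fun x => (1 + ‖grad u x‖ ^ 2) ^ (q / 2) * ‖fderiv ℝ η x‖ ^ 2) ⊆
      tsupport η :=
    closure_minimal (fun x hx => by_contra fun h => hx (by
      simp [fderiv_of_notMem_tsupport ℝ h])) (isClosed_tsupport η)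
  refine Continuous.integrable_of_hasCompactSupport (continuous_of_tsupport fun x hx => ?_)
    (hc.isCompact.of_isClosed_subset (isClosed_tsupport _) hsub)
  have hg : ContinuousAt (grad u) x :=
    (contDiffAt_grad (hu.contDiffAt (hΩ.mem_nhds (hs (hsub hx))))).continuousAt
  have hw : ContinuousAt (fun y => 1 + ‖grad u y‖ ^ 2) x :=
    continuousAt_const.add (hg.norm.pow 2)
  exact (hw.rpow_const (Or.inl (by positivity))).mul
    ((hη.continuous_fderiv (by norm_num)).continuousAt.norm.pow 2)

/-- Theorem 1.1 (estimate (1.9)): estimate for the derivative of V(Du). -/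
theorem statement1 {n N : ℕ} (hn : 1 ≤ n) (hN : 1 ≤ N) {p q m M : ℝ}
    (hp : 1 < p) (hpq : p ≤ q) (hm : 0 < m) (hM : 0 < M) :
    ∃ c > 0, ∀ (A : Vec n N → Vec n N), EllipticGrowth n N p q m M A →
      SkewControl n N p q M A →
      ∀ (Ω : Set (Pt n)), IsOpen Ω → Bornology.IsBounded Ω →
      ∀ (u : Pt n → EuclideanSpace ℝ (Fin N)), ContDiffOn ℝ 2 u Ω →
        IsWeakSolution A Ω u →
      ∀ (η : Pt n → ℝ), ContDiff ℝ (⊤ : ℕ∞) η → HasCompactSupport η → tsupport η ⊆ Ω →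
        ∫ x in Ω, gradVSq p u x * η x ^ 2 ≤
          c * ∫ x in Ω, (1 + ‖grad u x‖ ^ 2) ^ (q / 2) * ‖fderiv ℝ η x‖ ^ 2 := by
  set C₁ := (1 + |p - 2| / 2) ^ 2 * (4 / m) with hC₁
  set C₂ := (2 + ((n * N : ℕ) : ℝ) ^ 2 * M / m) * (((n * N : ℕ) : ℝ) ^ 2 * M) *
    ‖gradCLM n N‖ ^ 2 with hC₂
  have hC₁0 : 0 ≤ C₁ := by positivity
  have hC₂0 : 0 ≤ C₂ := by positivity
  refine ⟨n * (C₁ * C₂) + 1, by positivity, ?_⟩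
  intro A hA hskew Ω hΩ _ u hu hweak η hη hηc hηs
  have hη1 : ContDiff ℝ 1 η := hη.of_le (by norm_cast)
  set G : Pt n → Vec n N := fun y => A (grad u y) with hG
  set R : Pt n → ℝ := fun x => (1 + ‖grad u x‖ ^ 2) ^ (q / 2) * ‖fderiv ℝ η x‖ ^ 2 with hR
  set F : Fin n → Pt n → ℝ := fun s x => ⟪fderiv ℝ G x (EuclideanSpace.single s 1),
    grad (fun y => η y ^ 2 • fderiv ℝ u y (EuclideanSpace.single s 1)) x⟫_ℝ with hF
  have hR0 : ∀ x, 0 ≤ R x := fun x => by positivity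
  have huat : ∀ x ∈ Ω, ContDiffAt ℝ 2 u x := fun x hx => hu.contDiffAt (hΩ.mem_nhds hx)
  have hGd : ∀ x ∈ Ω, DifferentiableAt ℝ G x := fun x hx =>
    (hA.differentiable _).comp x ((contDiffAt_grad (huat x hx)).differentiableAt (by norm_num))
  have hGb : ∀ v, ∀ K ⊆ Ω, IsCompact K → ∃ C, ∀ x ∈ K, ‖fderiv ℝ G x v‖ ≤ C :=
    fun v K hKΩ hK => exists_bound_fderiv_comp_grad hA hΩ hu v hKΩ hK
  have hweak' : ∀ φ : Pt n → EuclideanSpace ℝ (Fin N), ContDiff ℝ (⊤ : ℕ∞) φ →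
      HasCompactSupport φ → tsupport φ ⊆ Ω → ∫ x in Ω, ⟪G x, grad φ x⟫_ℝ = 0 := by
    intro φ hφ hφc hφs
    rw [← hweak φ hφ hφc hφs]
    refine integral_congr_ae (Eventually.of_forall fun x => ?_)
    simp [PiLp.inner_apply, Fintype.sum_prod_type, grad_apply, hG, mul_comm]
  have hψ := fun s : Fin n =>
    contDiff_sq_smul_fderiv_apply hΩ hu hη1 hηs (EuclideanSpace.single s (1 : ℝ))
  have hψc := fun s => hηc.isCompact.of_isClosed_subset (isClosed_tsupport _) (hψ s).2
  have hFi : ∀ s, Integrable (F s) := fun s =>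
    integrable_inner_fderiv_grad (hGb _) (hψ s).1 (hψc s) ((hψ s).2.trans hηs)
  have hF0 : ∀ s, ∫ x in Ω, F s x = 0 := fun s => by
    rw [setIntegral_eq_integral_of_forall_compl_eq_zero fun x hx => ?_]
    · exact integral_inner_fderiv_grad_eq_zero hΩ hGd (hGb _) hweak' (hψ s).1 (hψc s)
        ((hψ s).2.trans hηs)
    · rw [hF]
      simp only
      rw [grad_eq_zero_of_notMem_tsupport fun h => hx (hηs ((hψ s).2 h)), inner_zero_right]
  have hRi : Integrable R := integrable_growth_mul_fderiv_sq q hΩ hu hη1 hηc hηs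
  have hFRi : ∀ s, IntegrableOn (fun x => C₁ * (F s x + C₂ * R x)) Ω := fun s =>
    (((hFi s).add (hRi.const_mul C₂)).const_mul C₁).integrableOn
  calc ∫ x in Ω, gradVSq p u x * η x ^ 2
      ≤ ∫ x in Ω, ∑ s, C₁ * (F s x + C₂ * R x) := by
        refine integral_mono_of_nonneg (Eventually.of_forall fun x => ?_) ?_
          (ae_restrict_of_forall_mem hΩ.measurableSet fun x hx => ?_)
        · exact mul_nonneg (Finset.sum_nonneg fun _ _ => sq_nonneg _) (sq_nonneg _)
        · exact integrable_finsetSum _ fun s _ => hFRi s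
        · simp only [gradVSq, Finset.sum_mul]
          exact Finset.sum_le_sum fun s _ => norm_fderiv_Vmap_grad_sq_mul_le hm hM hA hskew
            (huat x hx) (hη1.differentiable (by norm_num) x) s
    _ = n * (C₁ * C₂) * ∫ x in Ω, R x := by
        rw [integral_finsetSum _ fun s _ => hFRi s]
        have h : ∀ s, ∫ x in Ω, C₁ * (F s x + C₂ * R x) = C₁ * C₂ * ∫ x in Ω, R x := fun s => by
          rw [integral_const_mul, integral_add (hFi s).integrableOn
            (hRi.const_mul C₂).integrableOn, integral_const_mul, hF0]
          ring
        simp only [h, Finset.sum_const, Finset.card_univ, Fintype.card_fin, nsmul_eq_mul]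
        ring
    _ ≤ (n * (C₁ * C₂) + 1) * ∫ x in Ω, R x :=
        mul_le_mul_of_nonneg_right (by linarith) (integral_nonneg hR0)
end
end

section
/- Let A : ℝ^{nN} → ℝ^{nN} satisfy the (p,q)-ellipticity and growth conditions and the skew-symmetry control, let ε ∈ (0,1), and let u : Ω → ℝ^N be twice continuously differentiable and satisfy ∫_Ω Σ_{i=1}^n Σ_{α=1}^N A_{ε,i}^α(Du(x)) ∂φ^α/∂x_i(x) dx = 0 for every smooth φ : ℝⁿ → ℝ^N with compact support in Ω, where A_ε is the perturbed map. Then there exists a constant c > 0, depending only on n, N, p, q, m, M (in particular independent of ε and u), such that for every smooth compactly supported η : ℝⁿ → ℝ with support in Ω one has ∫_Ω (1+|Du|²)^{(p−2)/2}|D²u|² η² dx ≤ c ∫_Ω (1+|Du|²)^{q/2} |Dη|² dx + c ε ∫_Ω (1+|Du|²)^{max{q,2}/2} |Dη|² dx. -/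
open MeasureTheory Real

noncomputable section

open scoped Convolution Topology

lemma integrable_of_continuousOn_compact {E : Type*} [NormedAddCommGroup E] [MeasurableSpace E]
    [BorelSpace E] {μ : Measure E} [IsFiniteMeasureOnCompacts μ] {f : E → ℝ} {K : Set E}
    (hK : IsCompact K) (hf : ContinuousOn f K) (h0 : ∀ x ∉ K, f x = 0) : Integrable f μ :=
  (integrableOn_iff_integrable_of_support_subset
    (Function.support_subset_iff'.2 h0)).1 (hf.integrableOn_compact hK)

lemma integrable_of_bounded_compact {E : Type*} [NormedAddCommGroup E] [MeasurableSpace E]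
    [BorelSpace E] {μ : Measure E} [IsFiniteMeasureOnCompacts μ] {f : E → ℝ} {K : Set E} (hK : IsCompact K)
    (hf : Measurable f) {C : ℝ} (hC : ∀ x ∈ K, |f x| ≤ C) (h0 : ∀ x ∉ K, f x = 0) :
    Integrable f μ :=
  (integrableOn_iff_integrable_of_support_subset (Function.support_subset_iff'.2 h0)).1
    (Measure.integrableOn_of_bounded hK.measure_lt_top.ne hf.aestronglyMeasurable
      ((ae_restrict_iff' hK.measurableSet).2 (Filter.Eventually.of_forall hC)))

/-- The first partial derivatives of `F` times those of a compactly supported `C¹` function are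
integrable, as soon as the former are locally bounded. -/
lemma integrable_fderiv_mul_fderiv {E : Type*} [NormedAddCommGroup E] [NormedSpace ℝ E]
    [MeasurableSpace E] [BorelSpace E] {μ : Measure E} [IsFiniteMeasureOnCompacts μ]
    {ι : Type*} {F : ι → E → ℝ} {e : ι → E}
    {v : E} {Ω : Set E}
    (hb : ∀ K ⊆ Ω, IsCompact K → ∃ C, ∀ i, ∀ x ∈ K, |fderiv ℝ (F i) x v| ≤ C)
    {ψ : E → ℝ} (hψ : ContDiff ℝ 1 ψ) (hc : HasCompactSupport ψ) (hs : tsupport ψ ⊆ Ω) (i : ι) :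
    Integrable (fun x => fderiv ℝ (F i) x v * fderiv ℝ ψ x (e i)) μ := by
  obtain ⟨C, hC⟩ := hb _ hs hc.isCompact
  have hcont : Continuous fun x => fderiv ℝ ψ x (e i) :=
    (hψ.continuous_fderiv one_ne_zero).clm_apply continuous_const
  obtain ⟨D, hD⟩ := (hc.fderiv_apply ℝ (e i)).exists_bound_of_continuous hcont
  refine integrable_of_bounded_compact (C := C * D) hc.isCompact
    ((measurable_fderiv_apply_const ℝ _ _).mul hcont.measurable)
    (fun x hx => ?_) (fun x hx => ?_)
  · rw [abs_mul]
    exact mul_le_mul (hC i x hx) (hD x) (abs_nonneg _) ((abs_nonneg _).trans (hC i x hx))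
  · rw [image_eq_zero_of_notMem_tsupport (f := fun x => fderiv ℝ ψ x (e i))
      (fun h => hx (tsupport_fderiv_apply_subset ℝ (e i) h)), mul_zero]

section Integration

variable {E : Type*} [NormedAddCommGroup E] [NormedSpace ℝ E] [FiniteDimensional ℝ E]
  [MeasurableSpace E] [BorelSpace E] {μ : Measure E} [μ.IsAddHaarMeasure]

/-- A compactly supported `C¹` function is approximated by smooth functions supported in a common
compact set, with uniformly bounded and pointwise convergent derivatives. -/
lemma exists_smooth_approx (μ : Measure E) [μ.IsAddHaarMeasure]
    {ψ : E → ℝ} (hψ : ContDiff ℝ 1 ψ) (hc : HasCompactSupport ψ)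
    {Ω : Set E} (hΩ : IsOpen Ω) (hs : tsupport ψ ⊆ Ω) :
    ∃ (K : Set E) (C : ℝ) (φ : ℕ → E → ℝ), IsCompact K ∧ K ⊆ Ω ∧
      (∀ k, ContDiff ℝ (⊤ : ℕ∞) (φ k)) ∧ (∀ k, tsupport (φ k) ⊆ K) ∧
      (∀ k x, ‖fderiv ℝ (φ k) x‖ ≤ C) ∧
      ∀ x, Filter.Tendsto (fun k => fderiv ℝ (φ k) x) Filter.atTop (𝓝 (fderiv ℝ ψ x)) := by
  obtain ⟨δ, hδ, hδΩ⟩ := hc.isCompact.exists_cthickening_subset_open hΩ hs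
  have hcont : Continuous (fderiv ℝ ψ) := hψ.continuous_fderiv one_ne_zero
  obtain ⟨C, hC⟩ := (hc.fderiv (𝕜 := ℝ)).exists_bound_of_continuous hcont
  let ρ : ℕ → ContDiffBump (0 : E) := fun k =>
    { rIn := δ / (k + 1) / 2
      rOut := δ / (k + 1)
      rIn_pos := by positivity
      rIn_lt_rOut := half_lt_self (by positivity) }
  have hρ : Filter.Tendsto (fun k => (ρ k).rOut) Filter.atTop (𝓝 0) := by
    have := (tendsto_one_div_add_atTop_nhds_zero_nat (𝕜 := ℝ)).const_mul δ
    simpa [ρ, div_eq_mul_inv] using this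
  have hρδ : ∀ k, (ρ k).rOut ≤ δ := fun k =>
    div_le_self hδ.le (by linarith [Nat.cast_nonneg (α := ℝ) k])
  have hL : (ContinuousLinearMap.lsmul ℝ ℝ : ℝ →L[ℝ] ℝ →L[ℝ] ℝ).precompR E =
      (ContinuousLinearMap.lsmul ℝ ℝ : ℝ →L[ℝ] (E →L[ℝ] ℝ) →L[ℝ] (E →L[ℝ] ℝ)) := by
    ext a f
    simp
  have hd : ∀ k x, fderiv ℝ ((ρ k).normed μ ⋆[ContinuousLinearMap.lsmul ℝ ℝ, μ] ψ) x =
      ((ρ k).normed μ ⋆[ContinuousLinearMap.lsmul ℝ ℝ, μ] (fderiv ℝ ψ)) x := fun k x => by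
    rw [← hL]
    exact (hc.hasFDerivAt_convolution_right (ContinuousLinearMap.lsmul ℝ ℝ)
      (ρ k).integrable_normed.locallyIntegrable hψ x).fderiv
  refine ⟨Metric.cthickening δ (tsupport ψ), C + 2 * C,
    fun k => (ρ k).normed μ ⋆[ContinuousLinearMap.lsmul ℝ ℝ, μ] ψ,
    hc.isCompact.cthickening, hδΩ, fun k => ?_, fun k => ?_, fun k x => ?_, fun x => ?_⟩
  · exact (ρ k).hasCompactSupport_normed.contDiff_convolution_left _ (ρ k).contDiff_normed
      hψ.continuous.locallyIntegrable
  · refine closure_minimal ((support_convolution_subset _).trans ?_) Metric.isClosed_cthickening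
    rintro _ ⟨y, hy, z, hz, rfl⟩
    rw [(ρ k).support_normed_eq, mem_ball_zero_iff] at hy
    refine Metric.mem_cthickening_of_dist_le _ z _ _ (subset_closure hz) ?_
    simpa [dist_eq_norm] using hy.le.trans (hρδ k)
  · rw [hd]
    have h1 := (ρ k).dist_normed_convolution_le (μ := μ) (x₀ := x) (ε := 2 * C)
      hcont.aestronglyMeasurable (fun y _ => by
        rw [dist_eq_norm]
        linarith [norm_sub_le (fderiv ℝ ψ y) (fderiv ℝ ψ x), hC x, hC y])
    rw [dist_eq_norm] at h1
    have h2 := norm_add_le (fderiv ℝ ψ x)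
      (((ρ k).normed μ ⋆[ContinuousLinearMap.lsmul ℝ ℝ, μ] (fderiv ℝ ψ)) x - fderiv ℝ ψ x)
    rw [add_sub_cancel] at h2
    linarith [hC x]
  · simp_rw [hd]
    exact ContDiffBump.convolution_tendsto_right_of_continuous hρ hcont x

/-- If a locally Lipschitz, pointwise differentiable field is weakly divergence free, then so are
its partial derivatives, also when tested with `C¹` functions. -/
lemma integral_sum_fderiv_mul_fderiv_eq_zero {ι : Type*} [Fintype ι] {F : ι → E → ℝ} {e : ι → E}
    {v : E} {Ω : Set E} (hΩ : IsOpen Ω) (hF : ∀ i, DifferentiableOn ℝ (F i) Ω)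
    (hb : ∀ K ⊆ Ω, IsCompact K → ∃ C, ∀ i, ∀ x ∈ K, |fderiv ℝ (F i) x v| ≤ C)
    (hw : ∀ φ : E → ℝ, ContDiff ℝ (⊤ : ℕ∞) φ → HasCompactSupport φ → tsupport φ ⊆ Ω →
      ∫ x, ∑ i, F i x * fderiv ℝ φ x (e i) ∂μ = 0)
    {ψ : E → ℝ} (hψ : ContDiff ℝ 1 ψ) (hc : HasCompactSupport ψ) (hs : tsupport ψ ⊆ Ω) :
    ∫ x, ∑ i, fderiv ℝ (F i) x v * fderiv ℝ ψ x (e i) ∂μ = 0 := by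
  have hsmooth : ∀ φ : E → ℝ, ContDiff ℝ (⊤ : ℕ∞) φ → HasCompactSupport φ → tsupport φ ⊆ Ω →
      ∫ x, ∑ i, fderiv ℝ (F i) x v * fderiv ℝ φ x (e i) ∂μ = 0 := by
    intro φ hφ hcφ hsφ
    have hφd : ∀ w, ContDiff ℝ (⊤ : ℕ∞) (fun x => fderiv ℝ φ x w) := fun w =>
      (hφ.fderiv_right (by norm_cast)).clm_apply contDiff_const
    have hcd : ∀ w, HasCompactSupport (fun x => fderiv ℝ φ x w) := fun w => hcφ.fderiv_apply ℝ w
    have hsd : ∀ w, tsupport (fun x => fderiv ℝ φ x w) ⊆ tsupport φ := fun w =>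
      tsupport_fderiv_apply_subset ℝ w
    have hz : ∀ w, ∀ x ∉ tsupport φ, fderiv ℝ φ x w = 0 := fun w x hx =>
      image_eq_zero_of_notMem_tsupport (f := fun x => fderiv ℝ φ x w) fun h => hx (hsd w h)
    have hFK : ∀ i, ContinuousOn (F i) (tsupport φ) := fun i => (hF i).continuousOn.mono hsφ
    have hswap : ∀ i x, fderiv ℝ (fun y => fderiv ℝ φ y v) x (e i) =
        fderiv ℝ (fun y => fderiv ℝ φ y (e i)) x v := fun i x => by
      have hdd : DifferentiableAt ℝ (fderiv ℝ φ) x :=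
        ((hφ.fderiv_right (m := 1) (by norm_cast)).differentiable (by norm_num)) x
      rw [fderiv_clm_apply hdd (differentiableAt_const _),
        fderiv_clm_apply hdd (differentiableAt_const _)]
      simpa using (hφ.contDiffAt.isSymmSndFDerivAt (by simpa using WithTop.coe_le_coe.2 (le_top : (2 : ℕ∞) ≤ ⊤))) (e i) v
    have hint1 : ∀ i, Integrable (fun x => fderiv ℝ (F i) x v * fderiv ℝ φ x (e i)) μ :=
      integrable_fderiv_mul_fderiv hb (hφ.of_le (by norm_cast)) hcφ hsφ
    have hint2 : ∀ i, Integrable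
        (fun x => F i x * fderiv ℝ (fun y => fderiv ℝ φ y (e i)) x v) μ := fun i =>
      integrable_of_continuousOn_compact hcφ.isCompact ((hFK i).mul
        (((hφd (e i)).continuous_fderiv (by simp)).clm_apply continuous_const).continuousOn)
        (fun x hx => by
          rw [← hswap, image_eq_zero_of_notMem_tsupport
            (f := fun x => fderiv ℝ (fun y => fderiv ℝ φ y v) x (e i)) (fun h => hx (hsd v
            (tsupport_fderiv_apply_subset ℝ (e i) h))), mul_zero])
    have hint3 : ∀ i, Integrable (fun x => F i x * fderiv ℝ φ x (e i)) μ := fun i =>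
      integrable_of_continuousOn_compact hcφ.isCompact
        ((hFK i).mul (hφd (e i)).continuous.continuousOn)
        (fun x hx => by rw [hz _ x hx, mul_zero])
    have h := hw (fun x => fderiv ℝ φ x v) (hφd v) (hcd v) ((hsd v).trans hsφ)
    simp_rw [hswap] at h
    rw [integral_finsetSum _ fun i _ => hint2 i] at h
    rw [integral_finsetSum _ fun i _ => hint1 i, ← neg_eq_zero, ← h, ← Finset.sum_neg_distrib]
    refine Finset.sum_congr rfl fun i _ => ?_
    rw [integral_mul_fderiv_eq_neg_fderiv_mul_of_integrable (hint1 i) (hint2 i) (hint3 i)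
      (fun x hx => (hF i).differentiableAt (hΩ.mem_nhds (hsφ (hsd _ hx))))
      (fun x _ => (hφd (e i)).differentiable (by simp) x)]
  obtain ⟨K, C, φ, hK, hKΩ, hφ, hφK, hφC, hlim⟩ := exists_smooth_approx μ hψ hc hΩ hs
  obtain ⟨D, hD⟩ := hb K hKΩ hK
  have hDCT := tendsto_integral_of_dominated_convergence (μ := μ)
    (F := fun k x => ∑ i, fderiv ℝ (F i) x v * fderiv ℝ (φ k) x (e i))
    (f := fun x => ∑ i, fderiv ℝ (F i) x v * fderiv ℝ ψ x (e i))
    (K.indicator fun _ => ∑ i, D * (C * ‖e i‖)) ?_ ?_ ?_ ?_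
  · refine tendsto_nhds_unique hDCT ?_
    simp_rw [fun k => hsmooth (φ k) (hφ k) (hK.of_isClosed_subset (isClosed_tsupport _) (hφK k))
      ((hφK k).trans hKΩ)]
    exact tendsto_const_nhds
  · exact fun k => (Finset.measurable_sum _ fun i _ => (measurable_fderiv_apply_const ℝ _ _).mul
      (measurable_fderiv_apply_const ℝ _ _)).aestronglyMeasurable
  · exact (integrable_indicator_iff hK.measurableSet).2 (integrableOn_const hK.measure_lt_top.ne)
  · refine fun k => Filter.Eventually.of_forall fun x => ?_
    by_cases hx : x ∈ K
    · rw [Set.indicator_of_mem hx]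
      refine (norm_sum_le _ _).trans (Finset.sum_le_sum fun i _ => ?_)
      rw [norm_mul]
      exact mul_le_mul (hD i x hx) ((ContinuousLinearMap.le_opNorm _ _).trans
        (mul_le_mul_of_nonneg_right (hφC k x) (norm_nonneg _))) (norm_nonneg _)
        ((abs_nonneg _).trans (hD i x hx))
    · rw [Set.indicator_of_notMem hx, Finset.sum_eq_zero, norm_zero]
      intro i _
      have h0 : fderiv ℝ (φ k) x = 0 := image_eq_zero_of_notMem_tsupport fun h =>
        hx (hφK k (tsupport_fderiv_subset ℝ h))
      simp [h0]
  · exact Filter.Eventually.of_forall fun x => tendsto_finsetSum _ fun i _ =>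
      tendsto_const_nhds.mul (((ContinuousLinearMap.apply ℝ ℝ (e i)).continuous.tendsto _).comp
        (hlim x))

end Integration

section Algebra

lemma inner_clm_apply_eq_sum {ι : Type*} [Fintype ι] [DecidableEq ι]
    (T : EuclideanSpace ℝ ι →L[ℝ] EuclideanSpace ℝ ι) (ζ lam : EuclideanSpace ℝ ι) :
    inner ℝ ζ (T lam) = ∑ a, ∑ b, T (EuclideanSpace.single b 1) a * lam b * ζ a := by
  have h : lam = ∑ b, lam b • EuclideanSpace.single b (1 : ℝ) := by
    ext a
    simp [Finset.sum_apply, Pi.single_apply]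
  conv_lhs => rw [h, map_sum]
  simp only [map_smul, PiLp.inner_apply, WithLp.ofLp_sum, WithLp.ofLp_smul, Finset.sum_apply,
    Pi.smul_apply, smul_eq_mul, RCLike.inner_apply, conj_trivial, Finset.sum_mul]
  exact Finset.sum_congr rfl fun a _ => Finset.sum_congr rfl fun b _ => by ring

lemma sum_abs_le_sqrt_card_mul_norm {ι : Type*} [Fintype ι] (x : EuclideanSpace ℝ ι) :
    ∑ a, |x a| ≤ √(Fintype.card ι) * ‖x‖ := by
  refine abs_le_of_sq_le_sq' ?_ (by positivity) |>.2
  have h := sq_sum_le_card_mul_sum_sq (s := Finset.univ) (f := fun a => |x a|)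
  rw [mul_pow, Real.sq_sqrt (Nat.cast_nonneg _), EuclideanSpace.norm_sq_eq]
  simpa using h

lemma abs_sum_sum_mul_le {ι : Type*} [Fintype ι] {c : ι → ι → ℝ} {B : ℝ} (hB : 0 ≤ B)
    (hc : ∀ a b, |c a b| ≤ B) (ζ lam : EuclideanSpace ℝ ι) :
    |∑ a, ∑ b, c a b * lam b * ζ a| ≤ Fintype.card ι * B * (‖ζ‖ * ‖lam‖) := by
  have h1 : |∑ a, ∑ b, c a b * lam b * ζ a| ≤ B * ((∑ a, |ζ a|) * ∑ b, |lam b|) := by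
    rw [Finset.sum_mul_sum, Finset.mul_sum]
    refine (Finset.abs_sum_le_sum_abs _ _).trans (Finset.sum_le_sum fun a _ => ?_)
    rw [Finset.mul_sum]
    refine (Finset.abs_sum_le_sum_abs _ _).trans (Finset.sum_le_sum fun b _ => ?_)
    rw [abs_mul, abs_mul]
    calc |c a b| * |lam b| * |ζ a| = |c a b| * (|ζ a| * |lam b|) := by ring
      _ ≤ B * (|ζ a| * |lam b|) := mul_le_mul_of_nonneg_right (hc a b) (by positivity)
  have h2 := mul_le_mul (sum_abs_le_sqrt_card_mul_norm ζ) (sum_abs_le_sqrt_card_mul_norm lam)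
    (Finset.sum_nonneg fun _ _ => abs_nonneg _) (by positivity)
  calc _ ≤ _ := h1
    _ ≤ B * (√(Fintype.card ι) * ‖ζ‖ * (√(Fintype.card ι) * ‖lam‖)) :=
      mul_le_mul_of_nonneg_left h2 hB
    _ = (√(Fintype.card ι) * √(Fintype.card ι)) * B * (‖ζ‖ * ‖lam‖) := by ring
    _ = _ := by rw [Real.mul_self_sqrt (Nat.cast_nonneg _)]

/-- Cauchy–Schwarz for the symmetric part of an elliptic form, with its skew part absorbed by
Young's inequality. -/
lemma elliptic_form_lower_bound {H : Type*} [NormedAddCommGroup H] [InnerProductSpace ℝ H]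
    (T : H →L[ℝ] H) {m b P Q R : ℝ} (hm : 0 < m) (hP : 0 ≤ P) (hQ : 0 ≤ Q)
    (hR : R = √P * √Q) (ζ lam : H) (t : ℝ)
    (hell : ∀ x, m * P * ‖x‖ ^ 2 ≤ inner ℝ x (T x))
    (hgr : inner ℝ ζ (T ζ) ≤ b * Q * ‖ζ‖ ^ 2)
    (hsk : |inner ℝ ζ (T lam) - inner ℝ lam (T ζ)| ≤ b * R * (‖ζ‖ * ‖lam‖)) :
    m / 4 * (P * ‖lam‖ ^ 2 * t ^ 2) ≤
      t ^ 2 * inner ℝ lam (T lam) + 2 * t * inner ℝ ζ (T lam)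
        + (2 * b + b ^ 2 / m) * (Q * ‖ζ‖ ^ 2) := by
  have h1 : 0 ≤ inner ℝ (t • lam + (2 : ℝ) • ζ) (T (t • lam + (2 : ℝ) • ζ)) :=
    le_trans (by positivity) (hell _)
  simp only [map_add, map_smul, inner_add_left, inner_add_right, inner_smul_left,
    inner_smul_right, conj_trivial] at h1
  have h2 := mul_le_mul_of_nonneg_left (hell lam) (sq_nonneg t)
  have h3 : |t| * |inner ℝ ζ (T lam) - inner ℝ lam (T ζ)| ≤
      m / 4 * (P * ‖lam‖ ^ 2 * t ^ 2) + b ^ 2 / m * (Q * ‖ζ‖ ^ 2) := by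
    have h4 : |t| * (b * R * (‖ζ‖ * ‖lam‖)) ≤
        m / 4 * (√P * ‖lam‖ * |t|) ^ 2 + b ^ 2 / m * (√Q * ‖ζ‖) ^ 2 := by
      have h5 : 0 ≤ (m / 2 * (√P * ‖lam‖ * |t|) - b * (√Q * ‖ζ‖)) ^ 2 / m := by positivity
      rw [hR]
      calc |t| * (b * (√P * √Q) * (‖ζ‖ * ‖lam‖))
          ≤ |t| * (b * (√P * √Q) * (‖ζ‖ * ‖lam‖)) +
            (m / 2 * (√P * ‖lam‖ * |t|) - b * (√Q * ‖ζ‖)) ^ 2 / m := le_add_of_nonneg_right h5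
        _ = _ := by field_simp; ring
    rw [mul_pow, mul_pow, mul_pow, Real.sq_sqrt hP, Real.sq_sqrt hQ, sq_abs] at h4
    exact (mul_le_mul_of_nonneg_left hsk (abs_nonneg t)).trans h4
  rw [← abs_mul] at h3
  have h6 := neg_abs_le (t * (inner ℝ ζ (T lam) - inner ℝ lam (T ζ)))
  nlinarith [h1, h2, h3, h6, hgr]

/-- The form `ζ, λ ↦ P ⟪ζ, λ⟫ + R ⟪ξ, λ⟫ ⟪ζ, ξ⟫` is nonnegative, so completing the square bounds the
mixed term from below. -/
lemma radial_form_lower_bound {H : Type*} [NormedAddCommGroup H] [InnerProductSpace ℝ H]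
    {P R : ℝ} (hP : 0 ≤ P) (hR : 0 ≤ R) (ξ ζ lam : H) (t : ℝ) :
    0 ≤ t ^ 2 * inner ℝ lam (P • lam + (R * inner ℝ ξ lam) • ξ)
      + 2 * t * inner ℝ ζ (P • lam + (R * inner ℝ ξ lam) • ξ)
      + (P + R * ‖ξ‖ ^ 2) * ‖ζ‖ ^ 2 := by
  have h1 : 0 ≤ P * inner ℝ (t • lam + ζ) (t • lam + ζ) :=
    mul_nonneg hP real_inner_self_nonneg
  have h2 : 0 ≤ R * (inner ℝ ξ (t • lam + ζ)) ^ 2 := mul_nonneg hR (sq_nonneg _)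
  have h3 : R * (inner ℝ ξ ζ) ^ 2 ≤ R * (‖ξ‖ ^ 2 * ‖ζ‖ ^ 2) := by
    refine mul_le_mul_of_nonneg_left ?_ hR
    rw [← mul_pow]
    exact sq_le_sq' (neg_le_of_abs_le (abs_real_inner_le_norm _ _)) (real_inner_le_norm _ _)
  simp only [inner_add_left, inner_add_right, inner_smul_left, inner_smul_right, conj_trivial,
    real_inner_self_eq_norm_sq, real_inner_comm lam ζ, real_inner_comm ξ ζ,
    real_inner_comm ξ lam] at h1 h2 h3 ⊢
  nlinarith [h1, h2, h3]

end Algebra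

section Perturbed

variable {n N : ℕ} {p q m M ε : ℝ} {A : Vec n N → Vec n N}

lemma inner_fderiv_eq_sum_dA (A : Vec n N → Vec n N) (ξ ζ lam : Vec n N) :
    inner ℝ ζ (fderiv ℝ A ξ lam) = ∑ a : Fin n × Fin N, ∑ b : Fin n × Fin N,
      dA A ξ a.1 a.2 b.1 b.2 * lam b * ζ a :=
  inner_clm_apply_eq_sum _ _ _

lemma EllipticGrowth.le_inner (hA : EllipticGrowth n N p q m M A) (ξ lam : Vec n N) :
    m * (1 + ‖ξ‖ ^ 2) ^ ((p - 2) / 2) * ‖lam‖ ^ 2 ≤ inner ℝ lam (fderiv ℝ A ξ lam) := by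
  refine (hA.ellipticity ξ lam).trans_eq ?_
  rw [inner_fderiv_eq_sum_dA, Fintype.sum_prod_type]
  refine Finset.sum_congr rfl fun i _ => ?_
  rw [Finset.sum_comm]
  refine Finset.sum_congr rfl fun α _ => ?_
  rw [Fintype.sum_prod_type]
  exact Finset.sum_congr rfl fun j _ => Finset.sum_congr rfl fun β _ => by ring

lemma EllipticGrowth.inner_le (hM : 0 ≤ M) (hA : EllipticGrowth n N p q m M A) (ξ ζ : Vec n N) :
    inner ℝ ζ (fderiv ℝ A ξ ζ) ≤
      (Fintype.card (Fin n × Fin N) * M) * (1 + ‖ξ‖ ^ 2) ^ ((q - 2) / 2) * ‖ζ‖ ^ 2 := by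
  rw [inner_fderiv_eq_sum_dA]
  refine (le_abs_self _).trans ((abs_sum_sum_mul_le (B := M * (1 + ‖ξ‖ ^ 2) ^ ((q - 2) / 2))
    (by positivity) (fun a b => hA.growth _ _ _ _ _) ζ ζ).trans_eq (by ring))

lemma SkewControl.abs_inner_sub_le (hM : 0 ≤ M) (hA : SkewControl n N p q M A)
    (ξ ζ lam : Vec n N) :
    |inner ℝ ζ (fderiv ℝ A ξ lam) - inner ℝ lam (fderiv ℝ A ξ ζ)| ≤
      (Fintype.card (Fin n × Fin N) * M) * (1 + ‖ξ‖ ^ 2) ^ ((q + p - 4) / 4) *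
        (‖ζ‖ * ‖lam‖) := by
  have h : inner ℝ ζ (fderiv ℝ A ξ lam) - inner ℝ lam (fderiv ℝ A ξ ζ) =
      ∑ a : Fin n × Fin N, ∑ b : Fin n × Fin N,
        (dA A ξ a.1 a.2 b.1 b.2 - dA A ξ b.1 b.2 a.1 a.2) * lam b * ζ a := by
    rw [inner_fderiv_eq_sum_dA, inner_fderiv_eq_sum_dA, Finset.sum_comm (γ := Fin n × Fin N)
      (f := fun a b => dA A ξ a.1 a.2 b.1 b.2 * ζ b * lam a), ← Finset.sum_sub_distrib]
    refine Finset.sum_congr rfl fun a _ => ?_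
    rw [← Finset.sum_sub_distrib]
    exact Finset.sum_congr rfl fun b _ => by ring
  rw [h]
  exact (abs_sum_sum_mul_le (B := M * (1 + ‖ξ‖ ^ 2) ^ ((q + p - 4) / 4))
    (by positivity) (fun a b => hA _ _ _ _ _) ζ lam).trans_eq (by ring)

lemma EllipticGrowth.abs_fderiv_apply_le (hA : EllipticGrowth n N p q m M A) (ξ lam : Vec n N)
    (a : Fin n × Fin N) :
    |fderiv ℝ A ξ lam a| ≤ M * (1 + ‖ξ‖ ^ 2) ^ ((q - 2) / 2) * ∑ b, |lam b| := by
  have h := inner_fderiv_eq_sum_dA A ξ (EuclideanSpace.single a 1) lam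
  rw [EuclideanSpace.inner_single_left, Finset.sum_eq_single a (fun b _ hb => by simp [hb])
    (by simp)] at h
  simp only [map_one, one_mul, PiLp.single_apply, if_true, mul_one] at h
  rw [h, Finset.mul_sum]
  refine (Finset.abs_sum_le_sum_abs _ _).trans (Finset.sum_le_sum fun b _ => ?_)
  rw [abs_mul]
  exact mul_le_mul_of_nonneg_right (hA.growth _ _ _ _ _) (abs_nonneg _)

/-- The derivative of the `ε`-term of the perturbed map, without the factor `ε`. -/
def radialDeriv (s : ℝ) (ξ lam : Vec n N) : Vec n N :=
  (1 + ‖ξ‖ ^ 2) ^ s • lam + (2 * s * (1 + ‖ξ‖ ^ 2) ^ (s - 1) * inner ℝ ξ lam) • ξ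

lemma hasFDerivAt_Aeps (hA : Differentiable ℝ A) (ξ : Vec n N) :
    ∃ T : Vec n N →L[ℝ] Vec n N, HasFDerivAt (Aeps q ε A) T ξ ∧
      ∀ lam, T lam = fderiv ℝ A ξ lam + ε • radialDeriv ((max q 2 - 2) / 2) ξ lam := by
  have h1 : HasFDerivAt (fun η : Vec n N => 1 + ‖η‖ ^ 2) (2 • innerSL ℝ ξ) ξ :=
    (hasStrictFDerivAt_norm_sq ξ).hasFDerivAt.const_add 1
  have h2 := ((h1.rpow_const (p := (max q 2 - 2) / 2)
    (Or.inl (by positivity))).const_mul ε).smul (hasFDerivAt_id ξ)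
  refine ⟨_, (hA ξ).hasFDerivAt.add h2, fun lam => ?_⟩
  simp only [radialDeriv, add_apply, smul_apply,
    ContinuousLinearMap.smulRight_apply, ContinuousLinearMap.id_apply, innerSL_apply_apply, id,
    smul_add, smul_smul, nsmul_eq_mul, smul_eq_mul, Nat.cast_ofNat]
  congr 3
  ring

/-- Pointwise form of the Caccioppoli inequality. -/
lemma Aeps_form_lower_bound (hm : 0 < m) (hM : 0 ≤ M) (hε : 0 ≤ ε)
    (hA : EllipticGrowth n N p q m M A) (hS : SkewControl n N p q M A)
    (ξ ζ lam : Vec n N) (t : ℝ) :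
    m / 4 * ((1 + ‖ξ‖ ^ 2) ^ ((p - 2) / 2) * ‖lam‖ ^ 2 * t ^ 2) ≤
      t ^ 2 * inner ℝ lam (fderiv ℝ A ξ lam + ε • radialDeriv ((max q 2 - 2) / 2) ξ lam)
      + 2 * t * inner ℝ ζ (fderiv ℝ A ξ lam + ε • radialDeriv ((max q 2 - 2) / 2) ξ lam)
      + (2 * (Fintype.card (Fin n × Fin N) * M) + (Fintype.card (Fin n × Fin N) * M) ^ 2 / m) *
        ((1 + ‖ξ‖ ^ 2) ^ ((q - 2) / 2) * ‖ζ‖ ^ 2)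
      + ε * ((max q 2 - 1) * ((1 + ‖ξ‖ ^ 2) ^ ((max q 2 - 2) / 2) * ‖ζ‖ ^ 2)) := by
  set w := 1 + ‖ξ‖ ^ 2 with hw
  have hw0 : 0 < w := by positivity
  have hR : w ^ ((q + p - 4) / 4) = √(w ^ ((p - 2) / 2)) * √(w ^ ((q - 2) / 2)) := by
    rw [Real.sqrt_eq_rpow, Real.sqrt_eq_rpow, ← Real.rpow_mul hw0.le, ← Real.rpow_mul hw0.le,
      ← Real.rpow_add hw0]
    congr 1
    ring
  have h1 := elliptic_form_lower_bound (fderiv ℝ A ξ) hm (Real.rpow_nonneg hw0.le _)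
    (Real.rpow_nonneg hw0.le _) hR ζ lam t (hA.le_inner ξ) (hA.inner_le hM ξ ζ)
    (hS.abs_inner_sub_le hM ξ ζ lam)
  set s := (max q 2 - 2) / 2 with hs
  have hs0 : 0 ≤ s := by
    have := le_max_right q 2
    rw [hs]
    linarith
  have h2 := mul_nonneg hε (radial_form_lower_bound (Real.rpow_nonneg hw0.le s)
    (mul_nonneg (mul_nonneg zero_le_two hs0) (Real.rpow_nonneg hw0.le (s - 1))) ξ ζ lam t)
  have h3 : (w ^ s + 2 * s * w ^ (s - 1) * ‖ξ‖ ^ 2) * ‖ζ‖ ^ 2 ≤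
      (max q 2 - 1) * (w ^ s * ‖ζ‖ ^ 2) := by
    have h4 : w ^ (s - 1) * ‖ξ‖ ^ 2 ≤ w ^ s := by
      calc w ^ (s - 1) * ‖ξ‖ ^ 2 ≤ w ^ (s - 1) * w :=
            mul_le_mul_of_nonneg_left (by rw [hw]; linarith) (Real.rpow_nonneg hw0.le _)
        _ = w ^ s := by rw [← Real.rpow_add_one hw0.ne', sub_add_cancel]
    have h5 := mul_le_mul_of_nonneg_left h4 (mul_nonneg zero_le_two hs0)
    calc _ ≤ (w ^ s + 2 * s * w ^ s) * ‖ζ‖ ^ 2 :=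
          mul_le_mul_of_nonneg_right (by linarith) (sq_nonneg _)
      _ = _ := by rw [hs]; ring
  have h6 := mul_le_mul_of_nonneg_left h3 hε
  simp only [radialDeriv, inner_add_right, inner_smul_right (𝕜 := ℝ) (r := ε), ← hw] at h1 h2 ⊢
  linarith

end Perturbed

section Derivatives

variable {n N : ℕ} {Ω : Set (Pt n)} {u : Pt n → EuclideanSpace ℝ (Fin N)}

lemma fderiv_euclidean_apply {ι F : Type*} [Fintype ι] [NormedAddCommGroup F] [NormedSpace ℝ F]
    {f : F → EuclideanSpace ℝ ι} {x : F} (hf : DifferentiableAt ℝ f x) (v : F) (a : ι) :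
    fderiv ℝ f x v a = fderiv ℝ (fun y => f y a) x v :=
  (congrArg (fun L : F →L[ℝ] ℝ => L v)
    ((EuclideanSpace.proj (𝕜 := ℝ) a).hasFDerivAt.comp x hf.hasFDerivAt).fderiv).symm

lemma contDiffOn_fderiv_apply_apply (hΩ : IsOpen Ω) (hu : ContDiffOn ℝ 2 u Ω) (v : Pt n)
    (α : Fin N) : ContDiffOn ℝ 1 (fun y => fderiv ℝ u y v α) Ω :=
  contDiffOn_euclidean.1
    ((hu.fderiv_of_isOpen hΩ (by norm_num)).clm_apply contDiffOn_const) α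

lemma contDiffOn_grad (hΩ : IsOpen Ω) (hu : ContDiffOn ℝ 2 u Ω) :
    ContDiffOn ℝ 1 (grad u) Ω :=
  contDiffOn_euclidean.2 fun _ => contDiffOn_fderiv_apply_apply hΩ hu _ _

lemma differentiableAt_grad (hΩ : IsOpen Ω) (hu : ContDiffOn ℝ 2 u Ω) {x : Pt n} (hx : x ∈ Ω) :
    DifferentiableAt ℝ (grad u) x :=
  ((contDiffOn_grad hΩ hu).differentiableOn one_ne_zero).differentiableAt (hΩ.mem_nhds hx)

lemma fderiv_grad_apply (hΩ : IsOpen Ω) (hu : ContDiffOn ℝ 2 u Ω) {x : Pt n} (hx : x ∈ Ω)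
    (v : Pt n) (i : Fin n) (α : Fin N) :
    fderiv ℝ (grad u) x v (i, α) =
      fderiv ℝ (fun y => fderiv ℝ u y (EuclideanSpace.single i 1) α) x v :=
  fderiv_euclidean_apply (differentiableAt_grad hΩ hu hx) v (i, α)

lemma fderiv_fderiv_apply_apply_comm (hΩ : IsOpen Ω) (hu : ContDiffOn ℝ 2 u Ω) {x : Pt n}
    (hx : x ∈ Ω) (v w : Pt n) (α : Fin N) :
    fderiv ℝ (fun y => fderiv ℝ u y v α) x w = fderiv ℝ (fun y => fderiv ℝ u y w α) x v := by
  have hdd : DifferentiableAt ℝ (fderiv ℝ u) x :=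
    ((hu.fderiv_of_isOpen (m := 1) hΩ (by norm_num)).differentiableOn one_ne_zero).differentiableAt
      (hΩ.mem_nhds hx)
  have hdv : ∀ z : Pt n, DifferentiableAt ℝ (fun y => fderiv ℝ u y z) x := fun z =>
    hdd.clm_apply (differentiableAt_const z)
  rw [← fderiv_euclidean_apply (hdv v), ← fderiv_euclidean_apply (hdv w),
    fderiv_clm_apply hdd (differentiableAt_const _),
    fderiv_clm_apply hdd (differentiableAt_const _)]
  have hsymm := ((hu.contDiffAt (hΩ.mem_nhds hx)).isSymmSndFDerivAt (by simp)) w v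
  simp [hsymm]

lemma hessSq_eq_sum_norm_sq (hΩ : IsOpen Ω) (hu : ContDiffOn ℝ 2 u Ω) {x : Pt n} (hx : x ∈ Ω) :
    hessSq u x = ∑ s, ‖fderiv ℝ (grad u) x (EuclideanSpace.single s 1)‖ ^ 2 := by
  simp only [hessSq, EuclideanSpace.norm_sq_eq, Fintype.sum_prod_type, Real.norm_eq_abs, sq_abs,
    fderiv_grad_apply hΩ hu hx]
  exact Finset.sum_comm

lemma continuousOn_hessSq (hΩ : IsOpen Ω) (hu : ContDiffOn ℝ 2 u Ω) :
    ContinuousOn (hessSq u) Ω := by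
  have h : ContinuousOn (fderiv ℝ (grad u)) Ω :=
    (contDiffOn_grad hΩ hu).continuousOn_fderiv_of_isOpen hΩ le_rfl
  refine (continuousOn_finsetSum _ fun s _ => ((h.clm_apply continuousOn_const).norm.pow 2)).congr
    fun x hx => hessSq_eq_sum_norm_sq hΩ hu hx

lemma norm_grad_sq (x : Pt n) :
    ‖grad u x‖ ^ 2 = ∑ s : Fin n, ∑ α, (fderiv ℝ u x (EuclideanSpace.single s 1) α) ^ 2 := by
  simp [grad, EuclideanSpace.norm_sq_eq, Fintype.sum_prod_type]

lemma sum_fderiv_single_sq_le {ι : Type*} [Fintype ι] [DecidableEq ι]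
    (L : EuclideanSpace ℝ ι →L[ℝ] ℝ) :
    ∑ i, (L (EuclideanSpace.single i 1)) ^ 2 ≤ ‖L‖ ^ 2 := by
  set v : EuclideanSpace ℝ ι := ∑ i, L (EuclideanSpace.single i 1) • EuclideanSpace.single i 1
  have hv : ∀ i, v i = L (EuclideanSpace.single i 1) := fun i => by
    simp [v, Pi.single_apply]
  have hL : L v = ‖v‖ ^ 2 := by
    simp only [EuclideanSpace.norm_sq_eq, hv, Real.norm_eq_abs, sq_abs]
    simp [v, sq]
  have h1 : ‖v‖ ^ 2 ≤ ‖L‖ * ‖v‖ := hL ▸ (le_abs_self _).trans (L.le_opNorm v)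
  have h2 : ‖v‖ ≤ ‖L‖ := by
    by_contra! h
    nlinarith [norm_nonneg L, norm_nonneg v]
  calc _ = ‖v‖ ^ 2 := by simp [EuclideanSpace.norm_sq_eq, hv]
    _ ≤ _ := pow_le_pow_left₀ (norm_nonneg _) h2 2

end Derivatives

section TestFunction

variable {n N : ℕ} {Ω : Set (Pt n)} {u : Pt n → EuclideanSpace ℝ (Fin N)} {η : Pt n → ℝ}

/-- The component `η² ∂ᵥuᵅ` of the second-variation test function. -/
def secondVariationTest (η : Pt n → ℝ) (u : Pt n → EuclideanSpace ℝ (Fin N)) (v : Pt n)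
    (α : Fin N) (x : Pt n) : ℝ :=
  η x ^ 2 * fderiv ℝ u x v α

lemma tsupport_secondVariationTest_subset (v : Pt n) (α : Fin N) :
    tsupport (secondVariationTest η u v α) ⊆ tsupport η := by
  refine closure_mono fun x hx => ?_
  contrapose! hx
  simp only [Function.mem_support, not_not] at hx ⊢
  simp [secondVariationTest, hx]

lemma contDiff_secondVariationTest (hΩ : IsOpen Ω) (hu : ContDiffOn ℝ 2 u Ω)
    (hη : ContDiff ℝ (⊤ : ℕ∞) η) (hs : tsupport η ⊆ Ω) (v : Pt n) (α : Fin N) :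
    ContDiff ℝ 1 (secondVariationTest η u v α) := by
  refine contDiff_iff_contDiffAt.2 fun x => ?_
  by_cases hx : x ∈ Ω
  · exact ((hη.of_le (by norm_cast)).contDiffAt.pow 2).mul
      ((contDiffOn_fderiv_apply_apply hΩ hu v α).contDiffAt (hΩ.mem_nhds hx))
  · have h0 : secondVariationTest η u v α =ᶠ[𝓝 x] 0 :=
      notMem_tsupport_iff_eventuallyEq.1 fun h =>
        hx (hs (tsupport_secondVariationTest_subset v α h))
    exact contDiffAt_const.congr_of_eventuallyEq h0

lemma fderiv_secondVariationTest (hΩ : IsOpen Ω) (hu : ContDiffOn ℝ 2 u Ω)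
    (hη : ContDiff ℝ (⊤ : ℕ∞) η) (v : Pt n) (α : Fin N) {x : Pt n} (hx : x ∈ Ω) (i : Fin n) :
    fderiv ℝ (secondVariationTest η u v α) x (EuclideanSpace.single i 1) =
      η x ^ 2 * fderiv ℝ (grad u) x v (i, α) +
        2 * η x * (fderiv ℝ η x (EuclideanSpace.single i 1) * fderiv ℝ u x v α) := by
  have h1 : HasFDerivAt η (fderiv ℝ η x) x := (hη.differentiable (by simp) x).hasFDerivAt
  have h2 := (((contDiffOn_fderiv_apply_apply hΩ hu v α).differentiableOn
    one_ne_zero).differentiableAt (hΩ.mem_nhds hx)).hasFDerivAt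
  have h : fderiv ℝ (fun y => η y ^ 2 * fderiv ℝ u y v α) x = _ := ((h1.pow 2).mul h2).fderiv
  rw [show secondVariationTest η u v α = fun y => η y ^ 2 * fderiv ℝ u y v α from rfl, h,
    fderiv_grad_apply hΩ hu hx, fderiv_fderiv_apply_apply_comm hΩ hu hx _ v α]
  simp
  ring

end TestFunction

section SecondVariation

variable {n N : ℕ} {p q m M ε : ℝ} {A : Vec n N → Vec n N} {Ω : Set (Pt n)}
  {u : Pt n → EuclideanSpace ℝ (Fin N)} {η : Pt n → ℝ}

lemma IsWeakSolution.integral_component_eq_zero {B : Vec n N → Vec n N}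
    (hw : IsWeakSolution B Ω u) (α : Fin N) {φ : Pt n → ℝ} (hφ : ContDiff ℝ (⊤ : ℕ∞) φ)
    (hc : HasCompactSupport φ) (hs : tsupport φ ⊆ Ω) :
    ∫ x, ∑ i, B (grad u x) (i, α) * fderiv ℝ φ x (EuclideanSpace.single i 1) = 0 := by
  have hsub : tsupport (fun x => φ x • (EuclideanSpace.single α 1 : EuclideanSpace ℝ (Fin N))) ⊆
      tsupport φ := closure_mono (Function.support_smul_subset_left φ _)
  have h := hw (fun x => φ x • EuclideanSpace.single α 1) (hφ.smul contDiff_const)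
    (hc.of_isClosed_subset (isClosed_tsupport _) hsub) (hsub.trans hs)
  rw [setIntegral_eq_integral_of_forall_compl_eq_zero] at h
  · rw [← h]
    congr 1
    ext x
    have hd : HasFDerivAt φ (fderiv ℝ φ x) x := (hφ.differentiable (by simp) x).hasFDerivAt
    rw [(hd.smul_const (EuclideanSpace.single α 1 : EuclideanSpace ℝ (Fin N))).fderiv]
    simp
  · intro x hx
    have h0 : fderiv ℝ (fun x => φ x • (EuclideanSpace.single α 1 : EuclideanSpace ℝ (Fin N))) x
        = 0 := image_eq_zero_of_notMem_tsupport fun h' =>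
      hx (hs (hsub (tsupport_fderiv_subset ℝ h')))
    simp [h0]

lemma fderiv_Aeps_grad_apply (hA : Differentiable ℝ A) (hΩ : IsOpen Ω)
    (hu : ContDiffOn ℝ 2 u Ω) {x : Pt n} (hx : x ∈ Ω) (v : Pt n) (a : Fin n × Fin N) :
    DifferentiableAt ℝ (fun y => Aeps q ε A (grad u y) a) x ∧
    fderiv ℝ (fun y => Aeps q ε A (grad u y) a) x v =
      (fderiv ℝ A (grad u x) (fderiv ℝ (grad u) x v) +
        ε • radialDeriv ((max q 2 - 2) / 2) (grad u x) (fderiv ℝ (grad u) x v)) a := by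
  obtain ⟨T, hT, hTa⟩ := hasFDerivAt_Aeps (q := q) (ε := ε) hA (grad u x)
  have h := hT.comp x (differentiableAt_grad hΩ hu hx).hasFDerivAt
  refine ⟨differentiableAt_euclidean.1 h.differentiableAt a, ?_⟩
  rw [← hTa]
  refine (fderiv_euclidean_apply h.differentiableAt v a).symm.trans ?_
  rw [h.fderiv]
  rfl

lemma exists_bound_fderiv_Aeps_grad (hA : EllipticGrowth n N p q m M A) (hΩ : IsOpen Ω)
    (hu : ContDiffOn ℝ 2 u Ω) (v : Pt n) {K : Set (Pt n)} (hKΩ : K ⊆ Ω) (hK : IsCompact K) :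
    ∃ C, ∀ a, ∀ x ∈ K, |fderiv ℝ (fun y => Aeps q ε A (grad u y) a) x v| ≤ C := by
  have hg : ContinuousOn (grad u) K := (contDiffOn_grad hΩ hu).continuousOn.mono hKΩ
  have hl : ContinuousOn (fun x => fderiv ℝ (grad u) x v) K :=
    (((contDiffOn_grad hΩ hu).continuousOn_fderiv_of_isOpen hΩ le_rfl).clm_apply
      continuousOn_const).mono hKΩ
  have hpow : ∀ r : ℝ, ContinuousOn (fun x => (1 + ‖grad u x‖ ^ 2) ^ r) K := fun r =>
    (continuousOn_const.add (hg.norm.pow 2)).rpow_const fun x _ => Or.inl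
      (show 1 + ‖grad u x‖ ^ 2 ≠ 0 by positivity)
  have hl' : ∀ b, ContinuousOn (fun x => fderiv ℝ (grad u) x v b) K := fun b =>
    (EuclideanSpace.proj (𝕜 := ℝ) b).continuous.comp_continuousOn hl
  have hcont : ContinuousOn (fun x => M * (1 + ‖grad u x‖ ^ 2) ^ ((q - 2) / 2) *
      ∑ b, |fderiv ℝ (grad u) x v b| +
      ‖ε • radialDeriv ((max q 2 - 2) / 2) (grad u x) (fderiv ℝ (grad u) x v)‖) K := by
    refine ((continuousOn_const.mul (hpow _)).mul
      (continuousOn_finsetSum _ fun b _ => (hl' b).abs)).add (ContinuousOn.norm ?_)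
    unfold radialDeriv
    exact (((hpow ((max q 2 - 2) / 2)).smul hl).add (((continuousOn_const.mul
      (hpow ((max q 2 - 2) / 2 - 1))).mul (hg.inner hl)).smul hg)).const_smul ε
  obtain ⟨C, hC⟩ := hK.exists_bound_of_continuousOn hcont
  refine ⟨C, fun a x hx => ?_⟩
  rw [(fderiv_Aeps_grad_apply hA.differentiable hΩ hu (hKΩ hx) v a).2]
  refine le_trans ?_ ((le_abs_self _).trans (hC x hx))
  exact (abs_add_le _ _).trans (add_le_add (hA.abs_fderiv_apply_le _ _ _)
    (PiLp.norm_apply_le (ε • radialDeriv ((max q 2 - 2) / 2) (grad u x)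
      (fderiv ℝ (grad u) x v)) a))

/-- The integrand of the second variation of the perturbed system, tested with
`η² ∂ₛu` and summed over `s`. -/
def secondVariation (q ε : ℝ) (A : Vec n N → Vec n N) (u : Pt n → EuclideanSpace ℝ (Fin N))
    (η : Pt n → ℝ) (x : Pt n) : ℝ :=
  ∑ s : Fin n, ∑ α : Fin N, ∑ i : Fin n,
    fderiv ℝ (fun y => Aeps q ε A (grad u y) (i, α)) x (EuclideanSpace.single s 1) *
      fderiv ℝ (secondVariationTest η u (EuclideanSpace.single s 1) α) x
        (EuclideanSpace.single i 1)

lemma integral_secondVariation_eq_zero (hA : EllipticGrowth n N p q m M A) (hΩ : IsOpen Ω)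
    (hu : ContDiffOn ℝ 2 u Ω) (hw : IsWeakSolution (Aeps q ε A) Ω u)
    (hη : ContDiff ℝ (⊤ : ℕ∞) η) (hc : HasCompactSupport η) (hs : tsupport η ⊆ Ω) :
    Integrable (secondVariation q ε A u η) ∧ ∫ x, secondVariation q ε A u η x = 0 := by
  have key : ∀ (s : Fin n) (α : Fin N), Integrable (fun x => ∑ i : Fin n,
      fderiv ℝ (fun y => Aeps q ε A (grad u y) (i, α)) x (EuclideanSpace.single s 1) *
        fderiv ℝ (secondVariationTest η u (EuclideanSpace.single s 1) α) x
          (EuclideanSpace.single i 1)) ∧ ∫ x, ∑ i : Fin n,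
      fderiv ℝ (fun y => Aeps q ε A (grad u y) (i, α)) x (EuclideanSpace.single s 1) *
        fderiv ℝ (secondVariationTest η u (EuclideanSpace.single s 1) α) x
          (EuclideanSpace.single i 1) = 0 := fun s α => by
    have hb : ∀ K ⊆ Ω, IsCompact K → ∃ C, ∀ i : Fin n, ∀ x ∈ K,
        |fderiv ℝ (fun y => Aeps q ε A (grad u y) (i, α)) x (EuclideanSpace.single s 1)| ≤ C :=
      fun K hKΩ hK => (exists_bound_fderiv_Aeps_grad hA hΩ hu _ hKΩ hK).imp fun C hC i =>
        hC (i, α)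
    have hψ := contDiff_secondVariationTest hΩ hu hη hs (EuclideanSpace.single s 1) α
    have hsψ := tsupport_secondVariationTest_subset (u := u) (η := η)
      (EuclideanSpace.single s 1) α
    have hcψ := hc.of_isClosed_subset (isClosed_tsupport _) hsψ
    exact ⟨integrable_finsetSum _ fun i _ => integrable_fderiv_mul_fderiv
        (e := fun i => EuclideanSpace.single i 1) hb hψ hcψ (hsψ.trans hs) i,
      integral_sum_fderiv_mul_fderiv_eq_zero hΩ
        (fun i x hx => (fderiv_Aeps_grad_apply hA.differentiable hΩ hu hx 0
          (i, α)).1.differentiableWithinAt) hb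
        (fun φ hφ hcφ hsφ => hw.integral_component_eq_zero α hφ hcφ hsφ) hψ hcψ
        (hsψ.trans hs)⟩
  refine ⟨integrable_finsetSum _ fun s _ => integrable_finsetSum _ fun α _ => (key s α).1, ?_⟩
  unfold secondVariation
  rw [integral_finsetSum _ fun s _ => integrable_finsetSum _ fun α _ => (key s α).1]
  refine Finset.sum_eq_zero fun s _ => ?_
  rw [integral_finsetSum _ fun α _ => (key s α).1]
  exact Finset.sum_eq_zero fun α _ => (key s α).2

/-- `∂ᵥu ⊗ Dη` as a vector. -/
def tensorGrad (η : Pt n → ℝ) (u : Pt n → EuclideanSpace ℝ (Fin N)) (v x : Pt n) : Vec n N :=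
  WithLp.toLp 2 fun iα =>
    fderiv ℝ η x (EuclideanSpace.single iα.1 1) * fderiv ℝ u x v iα.2

lemma sum_norm_tensorGrad_sq_le (x : Pt n) :
    ∑ s : Fin n, ‖tensorGrad η u (EuclideanSpace.single s 1) x‖ ^ 2 ≤
      (1 + ‖grad u x‖ ^ 2) * ‖fderiv ℝ η x‖ ^ 2 := by
  have h : ∑ s : Fin n, ‖tensorGrad η u (EuclideanSpace.single s 1) x‖ ^ 2 =
      ‖grad u x‖ ^ 2 * ∑ i, (fderiv ℝ η x (EuclideanSpace.single i 1)) ^ 2 := by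
    rw [norm_grad_sq, Finset.sum_mul]
    refine Finset.sum_congr rfl fun s _ => ?_
    simp only [tensorGrad, EuclideanSpace.norm_sq_eq, Real.norm_eq_abs, sq_abs, mul_pow,
      Fintype.sum_prod_type, ← Finset.mul_sum, ← Finset.sum_mul]
    ring
  rw [h]
  exact mul_le_mul (by linarith) (sum_fderiv_single_sq_le _)
    (Finset.sum_nonneg fun _ _ => sq_nonneg _) (by positivity)

lemma secondVariation_eq (hA : Differentiable ℝ A) (hΩ : IsOpen Ω)
    (hu : ContDiffOn ℝ 2 u Ω) (hη : ContDiff ℝ (⊤ : ℕ∞) η) {x : Pt n} (hx : x ∈ Ω) :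
    secondVariation q ε A u η x = ∑ s : Fin n,
      (η x ^ 2 * inner ℝ (fderiv ℝ (grad u) x (EuclideanSpace.single s 1))
        (fderiv ℝ A (grad u x) (fderiv ℝ (grad u) x (EuclideanSpace.single s 1)) +
          ε • radialDeriv ((max q 2 - 2) / 2) (grad u x)
            (fderiv ℝ (grad u) x (EuclideanSpace.single s 1))) +
      2 * η x * inner ℝ (tensorGrad η u (EuclideanSpace.single s 1) x)
        (fderiv ℝ A (grad u x) (fderiv ℝ (grad u) x (EuclideanSpace.single s 1)) +
          ε • radialDeriv ((max q 2 - 2) / 2) (grad u x)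
            (fderiv ℝ (grad u) x (EuclideanSpace.single s 1)))) := by
  refine Finset.sum_congr rfl fun s _ => ?_
  simp only [fderiv_secondVariationTest hΩ hu hη _ _ hx,
    (fderiv_Aeps_grad_apply (q := q) (ε := ε) hA hΩ hu hx (EuclideanSpace.single s 1) _).2]
  generalize fderiv ℝ A (grad u x) (fderiv ℝ (grad u) x (EuclideanSpace.single s 1)) +
    ε • radialDeriv ((max q 2 - 2) / 2) (grad u x)
      (fderiv ℝ (grad u) x (EuclideanSpace.single s 1)) = τ
  simp only [PiLp.inner_apply, RCLike.inner_apply, conj_trivial, Fintype.sum_prod_type_right,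
    Finset.mul_sum, ← Finset.sum_add_distrib, tensorGrad]
  exact Finset.sum_congr rfl fun α _ => Finset.sum_congr rfl fun i _ => by ring

lemma le_secondVariation (hm : 0 < m) (hM : 0 ≤ M) (hε : 0 ≤ ε)
    (hA : EllipticGrowth n N p q m M A) (hS : SkewControl n N p q M A) (hΩ : IsOpen Ω)
    (hu : ContDiffOn ℝ 2 u Ω) (hη : ContDiff ℝ (⊤ : ℕ∞) η) {x : Pt n} (hx : x ∈ Ω) :
    m / 4 * ((1 + ‖grad u x‖ ^ 2) ^ ((p - 2) / 2) * hessSq u x * η x ^ 2) ≤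
      secondVariation q ε A u η x +
      (2 * (Fintype.card (Fin n × Fin N) * M) + (Fintype.card (Fin n × Fin N) * M) ^ 2 / m) *
        ((1 + ‖grad u x‖ ^ 2) ^ (q / 2) * ‖fderiv ℝ η x‖ ^ 2) +
      ε * ((max q 2 - 1) * ((1 + ‖grad u x‖ ^ 2) ^ (max q 2 / 2) * ‖fderiv ℝ η x‖ ^ 2)) := by
  have h := Finset.sum_le_sum fun (s : Fin n) (_ : s ∈ Finset.univ) =>
    Aeps_form_lower_bound hm hM hε hA hS (grad u x)
      (tensorGrad η u (EuclideanSpace.single s 1) x)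
      (fderiv ℝ (grad u) x (EuclideanSpace.single s 1)) (η x)
  rw [Finset.sum_add_distrib, Finset.sum_add_distrib,
    ← secondVariation_eq hA.differentiable hΩ hu hη hx] at h
  simp only [← Finset.mul_sum, ← Finset.sum_mul] at h
  rw [← hessSq_eq_sum_norm_sq hΩ hu hx] at h
  have hw0 : 0 < 1 + ‖grad u x‖ ^ 2 := by positivity
  have hr : ∀ r : ℝ, (1 + ‖grad u x‖ ^ 2) ^ ((r - 2) / 2) *
      ∑ s : Fin n, ‖tensorGrad η u (EuclideanSpace.single s 1) x‖ ^ 2 ≤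
      (1 + ‖grad u x‖ ^ 2) ^ (r / 2) * ‖fderiv ℝ η x‖ ^ 2 := fun r => by
    refine (mul_le_mul_of_nonneg_left (sum_norm_tensorGrad_sq_le x)
      (Real.rpow_nonneg hw0.le _)).trans_eq ?_
    rw [← mul_assoc, ← Real.rpow_add_one hw0.ne']
    congr 2
    ring
  have hC : 0 ≤ 2 * (Fintype.card (Fin n × Fin N) * M) +
      (Fintype.card (Fin n × Fin N) * M) ^ 2 / m := by positivity
  have hq : 0 ≤ max q 2 - 1 := by linarith [le_max_right q 2]
  linarith [mul_le_mul_of_nonneg_left (hr q) hC,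
    mul_le_mul_of_nonneg_left (mul_le_mul_of_nonneg_left (hr (max q 2)) hq) hε]

end SecondVariation

/-- Uniform higher order estimate (5.13)-(5.15) for solutions of the perturbed
system, with constant independent of ε. -/
theorem statement16 {n N : ℕ} (hn : 1 ≤ n) (hN : 1 ≤ N) {p q m M : ℝ}
    (hp : 1 < p) (hpq : p ≤ q) (hm : 0 < m) (hM : 0 < M) :
    ∃ c > 0, ∀ ε ∈ Set.Ioo (0 : ℝ) 1, ∀ (A : Vec n N → Vec n N),
      EllipticGrowth n N p q m M A → SkewControl n N p q M A →
      ∀ (Ω : Set (Pt n)), IsOpen Ω → Bornology.IsBounded Ω →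
      ∀ (u : Pt n → EuclideanSpace ℝ (Fin N)), ContDiffOn ℝ 2 u Ω →
        IsWeakSolution (Aeps q ε A) Ω u →
      ∀ (η : Pt n → ℝ), ContDiff ℝ (⊤ : ℕ∞) η → HasCompactSupport η → tsupport η ⊆ Ω →
        ∫ x in Ω, (1 + ‖grad u x‖ ^ 2) ^ ((p - 2) / 2) * hessSq u x * η x ^ 2 ≤
          c * (∫ x in Ω, (1 + ‖grad u x‖ ^ 2) ^ (q / 2) * ‖fderiv ℝ η x‖ ^ 2) +
          c * ε * ∫ x in Ω, (1 + ‖grad u x‖ ^ 2) ^ (max q 2 / 2) * ‖fderiv ℝ η x‖ ^ 2 := by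
  set C : ℝ := 2 * (Fintype.card (Fin n × Fin N) * M) +
    (Fintype.card (Fin n × Fin N) * M) ^ 2 / m with hCdef
  have hC : 0 ≤ C := by positivity
  have hq : 0 < max q 2 - 1 := by linarith [le_max_right q 2]
  refine ⟨4 / m * (C + (max q 2 - 1)), by positivity, ?_⟩
  intro ε hε A hA hS Ω hΩ _ u hu hw η hη hc hs
  have hη0 : ∀ x ∉ tsupport η, η x = 0 := fun x hx => image_eq_zero_of_notMem_tsupport hx
  have hdη0 : ∀ x ∉ tsupport η, fderiv ℝ η x = 0 := fun x hx =>
    image_eq_zero_of_notMem_tsupport fun h => hx (tsupport_fderiv_subset ℝ h)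
  have hg : ContinuousOn (grad u) (tsupport η) := (contDiffOn_grad hΩ hu).continuousOn.mono hs
  have hpow : ∀ r : ℝ, ContinuousOn (fun x => (1 + ‖grad u x‖ ^ 2) ^ r) (tsupport η) := fun r =>
    (continuousOn_const.add (hg.norm.pow 2)).rpow_const fun x _ => Or.inl
      (show 1 + ‖grad u x‖ ^ 2 ≠ 0 by positivity)
  have hL0 : ∀ x ∉ tsupport η,
      (1 + ‖grad u x‖ ^ 2) ^ ((p - 2) / 2) * hessSq u x * η x ^ 2 = 0 := fun x hx => by
    simp [hη0 x hx]
  have hR0 : ∀ (r : ℝ), ∀ x ∉ tsupport η,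
      (1 + ‖grad u x‖ ^ 2) ^ r * ‖fderiv ℝ η x‖ ^ 2 = 0 := fun r x hx => by simp [hdη0 x hx]
  have hLi : Integrable fun x =>
      (1 + ‖grad u x‖ ^ 2) ^ ((p - 2) / 2) * hessSq u x * η x ^ 2 :=
    integrable_of_continuousOn_compact hc.isCompact (((hpow _).mul
      ((continuousOn_hessSq hΩ hu).mono hs)).mul (hη.continuous.continuousOn.pow 2)) hL0
  have hRi : ∀ r : ℝ, Integrable fun x =>
      (1 + ‖grad u x‖ ^ 2) ^ r * ‖fderiv ℝ η x‖ ^ 2 := fun r =>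
    integrable_of_continuousOn_compact hc.isCompact ((hpow _).mul
      ((hη.continuous_fderiv (by simp)).continuousOn.norm.pow 2)) (hR0 r)
  rw [setIntegral_eq_integral_of_forall_compl_eq_zero fun x hx => hL0 x fun h => hx (hs h),
    setIntegral_eq_integral_of_forall_compl_eq_zero fun x hx => hR0 _ x fun h => hx (hs h),
    setIntegral_eq_integral_of_forall_compl_eq_zero fun x hx => hR0 _ x fun h => hx (hs h)]
  obtain ⟨hJi, hJ⟩ := integral_secondVariation_eq_zero hA hΩ hu hw hη hc hs
  have hmono := integral_mono (hLi.const_mul (m / 4))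
    ((hJi.add ((hRi (q / 2)).const_mul C)).add
      (((hRi (max q 2 / 2)).const_mul (max q 2 - 1)).const_mul ε)) fun x => by
    by_cases hx : x ∈ tsupport η
    · exact le_secondVariation hm hM.le hε.1.le hA hS hΩ hu hη (hs hx)
    · have h0 : secondVariation q ε A u η x = 0 :=
        Finset.sum_eq_zero fun s _ => Finset.sum_eq_zero fun α _ => Finset.sum_eq_zero fun i _ => by
          have : fderiv ℝ (secondVariationTest η u (EuclideanSpace.single s 1) α) x = 0 :=
            image_eq_zero_of_notMem_tsupport fun h =>
              hx (tsupport_secondVariationTest_subset _ _ (tsupport_fderiv_subset ℝ h))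
          simp [this]
      simp [hL0 x hx, hR0 _ x hx, h0]
  rw [integral_add' (hJi.add ((hRi (q / 2)).const_mul C))
      (((hRi (max q 2 / 2)).const_mul (max q 2 - 1)).const_mul ε),
    integral_add' hJi ((hRi (q / 2)).const_mul C), hJ, zero_add] at hmono
  simp only [integral_const_mul] at hmono
  have hI : ∀ r : ℝ, 0 ≤ ∫ x, (1 + ‖grad u x‖ ^ 2) ^ r * ‖fderiv ℝ η x‖ ^ 2 := fun r =>
    integral_nonneg fun x => by positivity
  have h1 := mul_nonneg hq.le (hI (q / 2))
  have h2 := mul_nonneg (mul_nonneg hC hε.1.le) (hI (max q 2 / 2))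
  calc _ = 4 / m * (m / 4 * ∫ x,
        (1 + ‖grad u x‖ ^ 2) ^ ((p - 2) / 2) * hessSq u x * η x ^ 2) := by field_simp
    _ ≤ 4 / m * ((C + (max q 2 - 1)) * (∫ x, (1 + ‖grad u x‖ ^ 2) ^ (q / 2) *
          ‖fderiv ℝ η x‖ ^ 2) + (C + (max q 2 - 1)) * ε *
          ∫ x, (1 + ‖grad u x‖ ^ 2) ^ (max q 2 / 2) * ‖fderiv ℝ η x‖ ^ 2) :=
        mul_le_mul_of_nonneg_left (by linarith) (by positivity)
    _ = _ := by ring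
end
end
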